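/- Let T be the spectrum of a discrete valuation ring with closed point 0 and let f : (x, X) -> (0, T) be a flat morphism, essentially of finite type, from a local scheme (x, X). Let Z0 be a closed subscheme of the special fiber X0 containing x such that depth_{Z0} X0 >= 2. Then the kernel of the restriction map Pic(X \ Z0) -> Pic(X0 \ Z0) is torsion free: if L is a line bundle on X \ Z0 whose restriction to X0 \ Z0 is trivial and some positive tensor power of L is trivial, then L itself is trivial. -/

import Mathlib

open AlgebraicGeometry CategoryTheory Opposite TopologicalSpace

universe u

namespace LocalPic

/-- Restriction of invertible sections along an inclusion of opens. -/
def resU (X : Scheme.{u}) {U V : X.Opens} (h : V ≤ U) :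
    (Γ(X, U))ˣ →* (Γ(X, V))ˣ :=
  Units.map (X.presheaf.map (homOfLE h).op).hom.toMonoidHom

/-- Restriction of sections along an inclusion of opens. -/
def resS (X : Scheme.{u}) {U V : X.Opens} (h : V ≤ U) : ↥Γ(X, U) →+* ↥Γ(X, V) :=
  (X.presheaf.map (homOfLE h).op).hom

lemma resU_resU (X : Scheme.{u}) {U V W : X.Opens} (h1 : W ≤ V) (h2 : V ≤ U)
    (u : (Γ(X, U))ˣ) :
    resU X h1 (resU X h2 u) = resU X (h1.trans h2) u := by
  ext
  show (X.presheaf.map (homOfLE h1).op) ((X.presheaf.map (homOfLE h2).op) u) = _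
  rw [← CommRingCat.comp_apply, ← Functor.map_comp, ← op_comp, homOfLE_comp]
  rfl

/-- A line bundle on the open subset `V` of a scheme `X`, presented by a Čech 1-cocycle
of invertible sections with respect to an open cover of `V`. -/
structure LineBundleOn (X : Scheme.{u}) (V : X.Opens) : Type (u + 1) where
  ι : Type u
  U : ι → X.Opens
  le : ∀ i, U i ≤ V
  covers : ∀ x ∈ V, ∃ i, x ∈ U i
  t : ∀ i j, (Γ(X, U i ⊓ U j))ˣ
  cocycle : ∀ i j k,
    resU X (inf_le_left : U i ⊓ U j ⊓ U k ≤ U i ⊓ U j) (t i j) *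
      resU X (le_inf (inf_le_left.trans inf_le_right) inf_le_right :
        U i ⊓ U j ⊓ U k ≤ U j ⊓ U k) (t j k) =
    resU X (le_inf (inf_le_left.trans inf_le_left) inf_le_right :
        U i ⊓ U j ⊓ U k ≤ U i ⊓ U k) (t i k)

namespace LineBundleOn

variable {X Y : Scheme.{u}} {V : X.Opens}

lemma cocycle_res (L : LineBundleOn X V) (i j k : L.ι) {W : X.Opens}
    (h : W ≤ L.U i ⊓ L.U j ⊓ L.U k)
    (h1 : W ≤ L.U i ⊓ L.U j) (h2 : W ≤ L.U j ⊓ L.U k) (h3 : W ≤ L.U i ⊓ L.U k) :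
    resU X h1 (L.t i j) * resU X h2 (L.t j k) = resU X h3 (L.t i k) := by
  have e := congrArg (resU X h) (L.cocycle i j k)
  rw [map_mul, resU_resU, resU_resU, resU_resU] at e
  exact e

/-- Tensor powers of a line bundle. -/
def pow (L : LineBundleOn X V) (n : ℕ) : LineBundleOn X V where
  ι := L.ι
  U := L.U
  le := L.le
  covers := L.covers
  t i j := (L.t i j) ^ n
  cocycle i j k := by rw [map_pow, map_pow, map_pow, ← mul_pow, L.cocycle]

/-- The inverse (dual) of a line bundle. -/
def inv (L : LineBundleOn X V) : LineBundleOn X V where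
  ι := L.ι
  U := L.U
  le := L.le
  covers := L.covers
  t i j := (L.t i j)⁻¹
  cocycle i j k := by rw [map_inv, map_inv, map_inv, ← mul_inv, L.cocycle]

/-- A line bundle is trivial if its cocycle is a coboundary, i.e. if it admits a
nowhere vanishing global section. -/
def IsTrivial (L : LineBundleOn X V) : Prop :=
  ∃ s : ∀ i, (Γ(X, L.U i))ˣ, ∀ i j,
    L.t i j = resU X inf_le_left (s i) * (resU X inf_le_right (s j))⁻¹

/-- A line bundle is torsion if some positive tensor power of it is trivial. -/
def IsTorsion (L : LineBundleOn X V) : Prop :=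
  ∃ n : ℕ, 0 < n ∧ IsTrivial (L.pow n)

def preimage_inf_le (f : Y ⟶ X) (A B : X.Opens) :
    f ⁻¹ᵁ A ⊓ f ⁻¹ᵁ B ≤ f ⁻¹ᵁ (A ⊓ B) := by
  intro x hx
  have hx' : x ∈ (↑(f ⁻¹ᵁ A ⊓ f ⁻¹ᵁ B) : Set Y) := hx
  rw [Opens.coe_inf] at hx'
  exact ⟨hx'.1, hx'.2⟩

/-- Mapping invertible sections along the pull-back of sections of a morphism. -/
def mapU (f : Y ⟶ X) {U : X.Opens} {W : Y.Opens} (e : W ≤ f ⁻¹ᵁ U) :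
    (Γ(X, U))ˣ →* (Γ(Y, W))ˣ :=
  Units.map (f.appLE U W e).hom.toMonoidHom

lemma resU_mapU (f : Y ⟶ X) {U : X.Opens} {W W' : Y.Opens} (e : W ≤ f ⁻¹ᵁ U)
    (h : W' ≤ W) (u : (Γ(X, U))ˣ) :
    resU Y h (mapU f e u) = mapU f (h.trans e) u := by
  ext
  show (Y.presheaf.map (homOfLE h).op) ((f.appLE U W e) u) = (f.appLE U W' _) u
  rw [← CommRingCat.comp_apply, Scheme.Hom.appLE_map]

lemma mapU_resU (f : Y ⟶ X) {U U' : X.Opens} {W : Y.Opens} (hU : U' ≤ U)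
    (e : W ≤ f ⁻¹ᵁ U') (e' : W ≤ f ⁻¹ᵁ U) (u : (Γ(X, U))ˣ) :
    mapU f e (resU X hU u) = mapU f e' u := by
  ext
  show (f.appLE U' W e) ((X.presheaf.map (homOfLE hU).op) u) = (f.appLE U W e') u
  rw [← CommRingCat.comp_apply, Scheme.Hom.map_appLE]

/-- Pullback of a line bundle along a morphism of schemes. -/
def pullback (f : Y ⟶ X) (L : LineBundleOn X V) : LineBundleOn Y (f ⁻¹ᵁ V) where
  ι := L.ι
  U i := f ⁻¹ᵁ L.U i
  le i x hx := L.le i hx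
  covers x hx := by
    obtain ⟨i, hi⟩ := L.covers (f.base x) hx
    exact ⟨i, hi⟩
  t i j := mapU f (preimage_inf_le f (L.U i) (L.U j)) (L.t i j)
  cocycle i j k := by
    rw [resU_mapU, resU_mapU, resU_mapU,
        ← mapU_resU f (inf_le_left : L.U i ⊓ L.U j ⊓ L.U k ≤ L.U i ⊓ L.U j),
        ← mapU_resU f (le_inf (inf_le_left.trans inf_le_right) inf_le_right :
          L.U i ⊓ L.U j ⊓ L.U k ≤ L.U j ⊓ L.U k),
        ← mapU_resU f (le_inf (inf_le_left.trans inf_le_left) inf_le_right :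
          L.U i ⊓ L.U j ⊓ L.U k ≤ L.U i ⊓ L.U k),
        ← map_mul, L.cocycle]
    all_goals
      intro x hx
      have hx' : x ∈ (↑(f ⁻¹ᵁ L.U i ⊓ f ⁻¹ᵁ L.U j ⊓ f ⁻¹ᵁ L.U k) : Set Y) := hx
      rw [Opens.coe_inf, Opens.coe_inf] at hx'
      exact ⟨⟨hx'.1.1, hx'.1.2⟩, hx'.2⟩

/-- Tensor product of two line bundles on the same open set. -/
def mul (L M : LineBundleOn X V) : LineBundleOn X V where
  ι := L.ι × M.ι
  U p := L.U p.1 ⊓ M.U p.2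
  le p := inf_le_left.trans (L.le p.1)
  covers x hx := by
    obtain ⟨i, hi⟩ := L.covers x hx
    obtain ⟨a, ha⟩ := M.covers x hx
    exact ⟨(i, a), ⟨hi, ha⟩⟩
  t p q := resU X (le_inf (inf_le_left.trans inf_le_left) (inf_le_right.trans inf_le_left))
      (L.t p.1 q.1) *
    resU X (le_inf (inf_le_left.trans inf_le_right) (inf_le_right.trans inf_le_right))
      (M.t p.2 q.2)
  cocycle := by
    rintro ⟨i, a⟩ ⟨j, b⟩ ⟨k, c⟩
    simp only [map_mul, resU_resU]
    rw [mul_mul_mul_comm,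
      L.cocycle_res i j k (h := le_inf (le_inf
        ((inf_le_left.trans inf_le_left).trans inf_le_left)
        ((inf_le_left.trans inf_le_right).trans inf_le_left))
        (inf_le_right.trans inf_le_left)),
      M.cocycle_res a b c (h := le_inf (le_inf
        ((inf_le_left.trans inf_le_left).trans inf_le_right)
        ((inf_le_left.trans inf_le_right).trans inf_le_right))
        (inf_le_right.trans inf_le_right))]

/-- Restriction of a line bundle to a smaller open set. -/
def restrict (L : LineBundleOn X V) {V' : X.Opens} (h : V' ≤ V) : LineBundleOn X V' where
  ι := L.ι
  U i := L.U i ⊓ V'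
  le i := inf_le_right
  covers x hx := by
    obtain ⟨i, hi⟩ := L.covers x (h hx)
    exact ⟨i, ⟨hi, hx⟩⟩
  t i j := resU X (le_inf (inf_le_left.trans inf_le_left)
      (inf_le_right.trans inf_le_left)) (L.t i j)
  cocycle i j k := by
    simp only [resU_resU]
    exact L.cocycle_res i j k (h := le_inf (le_inf
      (inf_le_left.trans (inf_le_left.trans inf_le_left))
      (inf_le_left.trans (inf_le_right.trans inf_le_left)))
      (inf_le_right.trans inf_le_left)) _ _ _

/-- Two line bundles are isomorphic iff `L ⊗ M⁻¹` is trivial. -/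
def Isomorphic (L M : LineBundleOn X V) : Prop :=
  IsTrivial (mul L (inv M))

end LineBundleOn

/-- `depth ≥ n` for a local ring: there is a weakly regular sequence of length `n`
inside the maximal ideal. -/
def DepthGE (R : Type u) [CommRing R] [IsLocalRing R] (n : ℕ) : Prop :=
  ∃ rs : List R, rs.length = n ∧ (∀ r ∈ rs, r ∈ IsLocalRing.maximalIdeal R) ∧
    RingTheory.Sequence.IsWeaklyRegular R rs


section PartA1
set_option linter.style.haveILetI false

/-- Length of the localization of a module at a prime. -/
noncomputable def lenAt {O : Type u} [CommRing O] (z : Ideal O) [z.IsPrime]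
    (M : Type u) [AddCommGroup M] [Module O M] : ℕ∞ :=
  Module.length (Localization.AtPrime z) (LocalizedModule z.primeCompl M)

section len
variable {O : Type u} [CommRing O] (z : Ideal O) [z.IsPrime]
  {M N P : Type u} [AddCommGroup M] [Module O M] [AddCommGroup N] [Module O N]
  [AddCommGroup P] [Module O P]

lemma lenAt_add (f : M →ₗ[O] N) (g : N →ₗ[O] P) (hf : Function.Injective f)
    (hg : Function.Surjective g) (H : Function.Exact f g) :
    lenAt z N = lenAt z M + lenAt z P := by
  unfold lenAt
  refine Module.length_eq_add_of_exact
    (IsLocalizedModule.mapExtendScalars z.primeCompl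
      (LocalizedModule.mkLinearMap z.primeCompl M)
      (LocalizedModule.mkLinearMap z.primeCompl N) (Localization.AtPrime z) f)
    (IsLocalizedModule.mapExtendScalars z.primeCompl
      (LocalizedModule.mkLinearMap z.primeCompl N)
      (LocalizedModule.mkLinearMap z.primeCompl P) (Localization.AtPrime z) g) ?_ ?_ ?_
  · exact IsLocalizedModule.map_injective z.primeCompl _ _ f hf
  · exact IsLocalizedModule.map_surjective z.primeCompl _ _ g hg
  · exact IsLocalizedModule.map_exact z.primeCompl _ _ _ f g H

lemma lenAt_congr (e : M ≃ₗ[O] N) : lenAt z M = lenAt z N := by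
  have := lenAt_add z (M := M) (N := N) (P := PUnit.{u+1}) e.toLinearMap 0 e.injective
    (fun x => ⟨0, Subsingleton.elim _ _⟩)
    (fun y => ⟨fun _ => e.surjective y, fun _ => Subsingleton.elim _ _⟩)
  rw [this]
  have : lenAt z PUnit.{u+1} = 0 := by
    unfold lenAt
    rw [Module.length_eq_zero_iff]
    infer_instance
  rw [this, add_zero]

lemma lenAt_of_subsingleton [Subsingleton M] : lenAt z M = 0 := by
  unfold lenAt
  rw [Module.length_eq_zero_iff]
  infer_instance

lemma lenAt_ne_zero (hM : ∃ m : M, ∀ s : O, s • m = 0 → s ∈ z) : lenAt z M ≠ 0 := by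
  unfold lenAt
  rw [Ne, Module.length_eq_zero_iff]
  intro h
  obtain ⟨m, hm⟩ := hM
  have := Subsingleton.elim (LocalizedModule.mk m (1 : z.primeCompl)) 0
  rw [← LocalizedModule.zero_mk (1 : z.primeCompl), LocalizedModule.mk_eq] at this
  obtain ⟨u, hu⟩ := this
  simp at hu
  exact u.2 (hm _ hu)

lemma lenAt_ne_top [IsNoetherianRing O] [Module.Finite O M]
    (h : ∀ p : Ideal O, p.IsPrime → p < z → ∃ c ∉ p, ∀ m : M, c • m = 0) :
    lenAt z M ≠ ⊤ := by
  unfold lenAt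
  set A := Localization.AtPrime z
  set Mz := LocalizedModule z.primeCompl M
  haveI : IsNoetherianRing A := IsLocalization.isNoetherianRing z.primeCompl A inferInstance
  haveI : Module.Finite A Mz := Module.Finite.of_isLocalizedModule z.primeCompl
    (LocalizedModule.mkLinearMap z.primeCompl M)
  set J := Module.annihilator A Mz
  haveI : Ring.KrullDimLE 0 (A ⧸ J) := by
    rw [Ring.krullDimLE_zero_iff]
    intro q hq
    have hq' : (q.comap (Ideal.Quotient.mk J)).IsPrime := inferInstance
    have : q.comap (Ideal.Quotient.mk J) = IsLocalRing.maximalIdeal A := by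
      by_contra hne
      have hlt : q.comap (Ideal.Quotient.mk J) < IsLocalRing.maximalIdeal A :=
        lt_of_le_of_ne (IsLocalRing.le_maximalIdeal hq'.ne_top) hne
      set q' := q.comap (Ideal.Quotient.mk J)
      have hlt' : q'.comap (algebraMap O A) < z := by
        have h1 : (IsLocalRing.maximalIdeal A).comap (algebraMap O A) = z :=
          Localization.AtPrime.under_maximalIdeal
        refine lt_of_le_of_ne ?_ ?_
        · exact (Ideal.comap_mono hlt.le).trans h1.le
        intro heq
        apply hne
        have e1 := IsLocalization.map_under z.primeCompl A q'
        have e2 := IsLocalization.map_under z.primeCompl A (IsLocalRing.maximalIdeal A)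
        rw [← e1, ← e2]
        exact congrArg (Ideal.map (algebraMap O A)) (heq.trans h1.symm)
      obtain ⟨c, hc, hcm⟩ := h _ inferInstance hlt'
      apply hc
      rw [Ideal.mem_comap]
      have : algebraMap O A c ∈ J := by
        rw [Module.mem_annihilator]
        intro m
        induction m using LocalizedModule.induction_on with
        | h m s =>
          rw [algebraMap_smul, LocalizedModule.smul'_mk, hcm, LocalizedModule.zero_mk]
      show Ideal.Quotient.mk J _ ∈ q
      rw [Ideal.Quotient.eq_zero_iff_mem.mpr this]
      exact q.zero_mem
    haveI : (q.comap (Ideal.Quotient.mk J)).IsMaximal := this ▸ inferInstance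
    have e3 : q = (q.comap (Ideal.Quotient.mk J)).map (Ideal.Quotient.mk J) :=
      (Ideal.map_comap_of_surjective _ Ideal.Quotient.mk_surjective q).symm
    refine ⟨⟨hq.ne_top, fun q2 hlt => ?_⟩⟩
    have h3 : q.comap (Ideal.Quotient.mk J) < q2.comap (Ideal.Quotient.mk J) := by
      refine lt_of_le_of_ne (Ideal.comap_mono hlt.le) ?_
      intro h4
      have := congrArg (Ideal.map (Ideal.Quotient.mk J)) h4
      rw [Ideal.map_comap_of_surjective _ Ideal.Quotient.mk_surjective,
        Ideal.map_comap_of_surjective _ Ideal.Quotient.mk_surjective] at this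
      exact hlt.ne this
    have h5 := this.1.2 _ h3
    exact Ideal.comap_eq_top_iff.mp h5
  haveI : IsArtinianRing (A ⧸ J) :=
    isArtinianRing_iff_isNoetherianRing_krullDimLE_zero.mpr ⟨inferInstance, inferInstance⟩
  letI : Module (A ⧸ J) Mz := Module.quotientAnnihilator
  haveI : IsScalarTower A (A ⧸ J) Mz := ⟨fun a b m => by
    obtain ⟨b, rfl⟩ := Ideal.Quotient.mk_surjective b
    show (a * b) • m = a • b • m
    rw [mul_smul]⟩
  haveI : Module.Finite (A ⧸ J) Mz := Module.Finite.of_restrictScalars_finite A (A ⧸ J) Mz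
  have e4 := Module.length_eq_of_surjective (S := A) (R := A ⧸ J) (M := Mz)
    Ideal.Quotient.mk_surjective
  exact e4 ▸ Module.length_ne_top
end len

end PartA1

section PartA2
set_option linter.style.haveILetI false

section plen
variable {O : Type u} [CommRing O] (z : Ideal O) [z.IsPrime]
  {P : Type u} [AddCommGroup P] [Module O P] {P' : Type u} [AddCommGroup P'] [Module O P']

lemma mem_subOf {N N' : Submodule O P} {x : N'} : x ∈ N.submoduleOf N' ↔ (x : P) ∈ N := Iff.rfl

/-- Length at `z` of the quotient of `N'` by (the trace of) `N`. -/
noncomputable def plen (N' N : Submodule O P) : ℕ∞ := lenAt z (N' ⧸ N.submoduleOf N')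

lemma plen_map {N' N : Submodule O P} {Q' Q : Submodule O P'} (φ : N' →ₗ[O] P')
    (h1 : ∀ b, φ b ∈ Q') (h2 : ∀ q ∈ Q', ∃ b, φ b - q ∈ Q)
    (h3 : ∀ b : N', φ b ∈ Q ↔ (b : P) ∈ N) : plen z N' N = plen z Q' Q := by
  let ψ : N' →ₗ[O] (Q' ⧸ Q.submoduleOf Q') := (Submodule.mkQ _).comp (φ.codRestrict Q' h1)
  have hk : LinearMap.ker ψ = N.submoduleOf N' := by
    ext b
    rw [LinearMap.mem_ker, mem_subOf, ← h3]
    show Submodule.Quotient.mk _ = _ ↔ _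
    rw [Submodule.Quotient.mk_eq_zero, mem_subOf]
    rfl
  have hs : Function.Surjective ψ := by
    intro q
    obtain ⟨q, rfl⟩ := Submodule.Quotient.mk_surjective _ q
    obtain ⟨b, hb⟩ := h2 q q.2
    refine ⟨b, ?_⟩
    show Submodule.Quotient.mk _ = _
    rw [Submodule.Quotient.eq, mem_subOf]
    exact hb
  exact lenAt_congr z ((Submodule.quotEquivOfEq _ _ hk.symm).trans
    (ψ.quotKerEquivOfSurjective hs))

lemma plen_self (N : Submodule O P) : plen z N N = 0 := by
  have : N.submoduleOf N = ⊤ := Submodule.submoduleOf_self N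
  unfold plen
  haveI : Subsingleton (N ⧸ N.submoduleOf N) := Submodule.Quotient.subsingleton_iff.mpr this
  exact lenAt_of_subsingleton z

lemma plen_add {N0 N1 N2 : Submodule O P} (h1 : N0 ≤ N1) (h2 : N1 ≤ N2) :
    plen z N2 N0 = plen z N2 N1 + plen z N1 N0 := by
  unfold plen
  rw [add_comm]
  have i1 : N0.submoduleOf N1 ≤ (N0.submoduleOf N2).comap (Submodule.inclusion h2) :=
    fun x hx => hx
  have i2 : N0.submoduleOf N2 ≤ (N1.submoduleOf N2).comap LinearMap.id :=
    fun x hx => h1 hx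
  refine lenAt_add z
    (Submodule.mapQ (N0.submoduleOf N1) (N0.submoduleOf N2) (Submodule.inclusion h2) i1)
    (Submodule.mapQ (N0.submoduleOf N2) (N1.submoduleOf N2) LinearMap.id i2) ?_ ?_ ?_
  · rw [injective_iff_map_eq_zero]
    intro x hx
    obtain ⟨x, rfl⟩ := Submodule.Quotient.mk_surjective _ x
    rw [Submodule.mapQ_apply, Submodule.Quotient.mk_eq_zero] at hx
    rw [Submodule.Quotient.mk_eq_zero]
    exact hx
  · intro x
    obtain ⟨x, rfl⟩ := Submodule.Quotient.mk_surjective _ x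
    exact ⟨Submodule.Quotient.mk x, rfl⟩
  · intro x
    obtain ⟨x, rfl⟩ := Submodule.Quotient.mk_surjective _ x
    rw [Submodule.mapQ_apply, Submodule.Quotient.mk_eq_zero]
    constructor
    · intro hx
      exact ⟨Submodule.Quotient.mk ⟨x, hx⟩, rfl⟩
    · rintro ⟨y, hy⟩
      obtain ⟨y, rfl⟩ := Submodule.Quotient.mk_surjective _ y
      rw [Submodule.mapQ_apply, Submodule.Quotient.eq] at hy
      have h3 : (y : P) - x ∈ N0 := hy
      have h4 := N1.sub_mem y.2 (h1 h3)
      show (x : P) ∈ N1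
      simpa using h4

lemma plen_ne_top [IsNoetherianRing O] {N' N : Submodule O P} (hfg : N'.FG)
    (h : ∀ p : Ideal O, p.IsPrime → p < z → ∃ c ∉ p, ∀ m ∈ N', c • m ∈ N) :
    plen z N' N ≠ ⊤ := by
  haveI : Module.Finite O N' := Module.Finite.iff_fg.mpr hfg
  refine lenAt_ne_top z ?_
  intro p hp hlt
  obtain ⟨c, hc, hcm⟩ := h p hp hlt
  refine ⟨c, hc, fun m => ?_⟩
  obtain ⟨m, rfl⟩ := Submodule.Quotient.mk_surjective _ m
  rw [← Submodule.Quotient.mk_smul, Submodule.Quotient.mk_eq_zero]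
  exact hcm _ m.2

lemma plen_ne_zero {N' N : Submodule O P} (h : ∃ m ∈ N', ∀ s : O, s • m ∈ N → s ∈ z) :
    plen z N' N ≠ 0 := by
  obtain ⟨m, hm, hs⟩ := h
  refine lenAt_ne_zero z ⟨Submodule.Quotient.mk ⟨m, hm⟩, fun s h => ?_⟩
  rw [← Submodule.Quotient.mk_smul, Submodule.Quotient.mk_eq_zero] at h
  exact hs s h

end plen

/-- Difference operator. -/
def dif (h : ℕ → ℤ) : ℕ → ℤ := fun j => h (j + 1) - h j

/-- Eventually polynomial functions. -/
def EP (h : ℕ → ℤ) : Prop := ∃ d m, ∀ j ≥ m, (dif^[d] h) j = 0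

lemma dif_sub (h k : ℕ → ℤ) : dif (h - k) = dif h - dif k := by
  funext j; simp [dif]; ring

lemma dif_iter_sub (d : ℕ) : ∀ h k : ℕ → ℤ, dif^[d] (h - k) = dif^[d] h - dif^[d] k := by
  induction d with
  | zero => intro h k; rfl
  | succ d ih => intro h k; simp only [Function.iterate_succ, Function.comp]; rw [dif_sub, ih]

lemma EP_aux {h : ℕ → ℤ} {d m : ℕ} (H : ∀ j ≥ m, (dif^[d] h) j = 0) (e : ℕ) :
    ∀ j ≥ m, (dif^[e + d] h) j = 0 := by
  induction e with
  | zero => simpa using H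
  | succ e ih =>
    intro j hj
    have : e + 1 + d = (e + d) + 1 := by ring
    rw [this, Function.iterate_succ_apply']
    simp [dif, ih j hj, ih (j+1) (by omega)]

lemma EP.sub {h k : ℕ → ℤ} (H : EP h) (K : EP k) : EP (h - k) := by
  obtain ⟨d, m, H⟩ := H
  obtain ⟨e, l, K⟩ := K
  refine ⟨e + d, m + l, fun j hj => ?_⟩
  rw [dif_iter_sub]
  have h1 := EP_aux H e j (by omega)
  have h2 := EP_aux K d j (by omega)
  rw [add_comm] at h2
  simp [h1, h2]

lemma EP.of_dif {h : ℕ → ℤ} (H : EP (dif h)) : EP h := by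
  obtain ⟨d, m, H⟩ := H
  exact ⟨d + 1, m, H⟩

lemma EP.shift {h : ℕ → ℤ} (H : EP h) : EP (fun j => h (j + 1)) := by
  obtain ⟨d, m, H⟩ := H
  refine ⟨d, m, ?_⟩
  have : ∀ (d : ℕ) (h : ℕ → ℤ), dif^[d] (fun j => h (j + 1)) = fun j => (dif^[d] h) (j + 1) := by
    intro d
    induction d with
    | zero => intro h; rfl
    | succ d ih =>
      intro h
      simp only [Function.iterate_succ, Function.comp]
      rw [← ih]
      rfl
  rw [this]
  intro j hj
  exact H (j + 1) (by omega)

lemma EP.const_of_periodic {n : ℕ} (hn : 0 < n) {h : ℕ → ℤ} (H : EP h)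
    (hp : ∀ j, h (j + n) = h j) : ∀ j, h j = h 0 := by
  obtain ⟨d, m, H⟩ := H
  induction d generalizing h with
  | zero =>
    have hz : ∀ j, h j = 0 := by
      intro j
      have : ∀ k, h (j + k * n) = h j := by
        intro k
        induction k with
        | zero => simp
        | succ k ih => rw [show j + (k + 1) * n = (j + k * n) + n by ring, hp, ih]
      rw [← this m]
      apply H
      nlinarith
    intro j; rw [hz, hz]
  | succ d ih =>
    have h1 := ih (h := dif h) (by intro j; simp only [dif]; rw [hp j, ← hp (j+1)]; ring_nf) H
    have h2 : ∀ j : ℕ, h j = h 0 + j * dif h 0 := by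
      intro j
      induction j with
      | zero => simp
      | succ j ihj =>
        have := h1 j
        have h0 : dif h j = h (j+1) - h j := rfl
        push_cast
        linear_combination this + ihj - h0
    have h3 := h2 n
    have h4 : h n = h 0 := by simpa using hp 0
    have h5 : dif h 0 = 0 := by
      have : (n : ℤ) * dif h 0 = 0 := by linarith
      rcases mul_eq_zero.mp this with h | h
      · exfalso; omega
      · exact h
    intro j
    rw [h2 j, h5]; simp


end PartA2

section PartA3
set_option linter.style.haveILetI false

section hilb
variable {O : Type u} [CommRing O] {P : Type u} [CommRing P] [Algebra O P]

/-- A family of submodules stable under multiplication by the elements of `fs`. -/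
def Stab (fs : Finset P) (S : ℕ → Submodule O P) : Prop :=
  ∀ f ∈ fs, ∀ j, ∀ b ∈ S j, f * b ∈ S (j + 1)

open Polynomial in
lemma stab_acc [IsNoetherianRing O] (fs : Finset P) (S : ℕ → ℕ → Submodule O P)
    (hS : ∀ m, Stab fs (S m)) (hle : ∀ m j, S m j ≤ (Submodule.span O (fs : Set P)) ^ j)
    (hmono : ∀ m j, S m j ≤ S (m + 1) j) :
    ∃ m0, ∀ m ≥ m0, ∀ j, S m j ≤ S m0 j := by
  classical
  let gs : Finset P[X] := fs.image (fun f => C f * X)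
  let 𝓡 : Subalgebra O P[X] := Algebra.adjoin O (gs : Set P[X])
  haveI : Algebra.FiniteType O 𝓡 :=
    (Subalgebra.fg_iff_finiteType _).mp ⟨gs, rfl⟩
  haveI : IsNoetherianRing 𝓡 := 
    Algebra.FiniteType.isNoetherianRing O _
  have key : ∀ m, ∀ a ∈ 𝓡, ∀ r : P[X], (∀ j, r.coeff j ∈ S m j) →
      ∀ j, (a * r).coeff j ∈ S m j := by
    intro m a ha
    induction ha using Algebra.adjoin_induction with
    | mem x hx =>
      intro r hr j
      simp only [gs, Finset.coe_image, Set.mem_image, Finset.mem_coe] at hx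
      obtain ⟨f, hf, rfl⟩ := hx
      rw [mul_assoc, coeff_C_mul]
      cases j with
      | zero => simp
      | succ j =>
        rw [coeff_X_mul]
        exact hS m f hf j _ (hr j)
    | algebraMap o =>
      intro r hr j
      rw [← Algebra.smul_def, coeff_smul]
      exact (S m j).smul_mem _ (hr j)
    | add x y _ _ hx hy =>
      intro r hr j
      rw [add_mul, coeff_add]
      exact (S m j).add_mem (hx r hr j) (hy r hr j)
    | mul x y _ _ hx hy =>
      intro r hr j
      rw [mul_assoc]
      exact hx _ (hy r hr) j
  let J : ℕ →o Ideal 𝓡 :=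
    { toFun := fun m =>
        { carrier := {r | ∀ j, (r : P[X]).coeff j ∈ S m j}
          add_mem' := by
            intro a b ha hb j
            show ((a : P[X]) + (b : P[X])).coeff j ∈ _
            rw [coeff_add]
            exact (S m j).add_mem (ha j) (hb j)
          zero_mem' := by
            intro j
            show ((0 : P[X])).coeff j ∈ _
            simp
          smul_mem' := by
            intro a r hr j
            exact key m a a.2 r hr j }
      monotone' := by
        refine monotone_nat_of_le_succ ?_
        intro m r hr j
        exact hmono m j (hr j) }
  obtain ⟨m0, hm0⟩ := monotone_stabilizes_iff_noetherian.mpr inferInstance J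
  refine ⟨m0, fun m hm j b hb => ?_⟩
  have hmem : ∀ j, ∀ b ∈ (Submodule.span O (fs : Set P)) ^ j, monomial j b ∈ 𝓡 := by
    intro j
    induction j with
    | zero =>
      intro b hb
      rw [pow_zero, Submodule.mem_one] at hb
      obtain ⟨o, rfl⟩ := hb
      exact 𝓡.algebraMap_mem o
    | succ j ih =>
      intro b hb
      rw [pow_succ'] at hb
      refine Submodule.mul_induction_on hb ?_ ?_
      · intro a ha b hb
        have h2 := ih b hb
        induction ha using Submodule.span_induction with
        | mem x hx =>
          have : monomial (j + 1) (x * b) = (C x * X) * monomial j b := by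
            rw [add_comm, ← monomial_mul_monomial, ← C_mul_X_eq_monomial]
          rw [this]
          refine 𝓡.mul_mem (Algebra.subset_adjoin ?_) h2
          simp only [gs, Finset.coe_image, Set.mem_image, Finset.mem_coe]
          exact ⟨x, hx, rfl⟩
        | zero => rw [zero_mul, map_zero]; exact 𝓡.zero_mem
        | add x y _ _ hx hy => rw [add_mul, map_add]; exact 𝓡.add_mem hx hy
        | smul o x _ hx =>
          rw [smul_mul_assoc, ← smul_monomial]
          exact 𝓡.smul_mem hx o
      · intro x y hx hy
        rw [map_add]; exact 𝓡.add_mem hx hy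
  have h1 : (⟨monomial j b, hmem j b (hle m j hb)⟩ : 𝓡) ∈ J m := by
    intro i
    show (monomial j b).coeff i ∈ S m i
    rw [coeff_monomial]
    split_ifs with h
    · exact h ▸ hb
    · exact zero_mem _
  rw [← hm0 m hm] at h1
  have h2 := h1 j
  change (monomial j b).coeff j ∈ S m0 j at h2
  rwa [coeff_monomial, if_pos rfl] at h2

variable (z : Ideal O) [z.IsPrime]

lemma hilbert [IsNoetherianRing O] (fs : Finset P) (l : List P) (hl : ∀ x ∈ l, x ∈ fs) :
    ∀ (N' N : ℕ → Submodule O P), Stab fs N' → Stab fs N →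
    (∀ j, N j ≤ N' j) → (∀ j, N' j ≤ (Submodule.span O (fs : Set P)) ^ j) →
    (∀ f ∈ fs, f ∈ l ∨ ∀ j, ∀ b ∈ N' j, f * b ∈ N (j + 1)) →
    (∀ j, plen z (N' j) (N j) ≠ ⊤) →
    EP (fun j => ((plen z (N' j) (N j)).toNat : ℤ)) := by
  induction l with
  | nil =>
    intro N' N hN' hN hle hF hk hfin
    have H : ∃ m0, ∀ m ≥ m0, ∀ j, (if j < m then N' j else N j) ≤
        (if j < m0 then N' j else N j) := by
      refine stab_acc fs (fun m j => if j < m then N' j else N j) ?_ ?_ ?_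
      · intro m f hf j b hb
        dsimp only at hb ⊢
        have h1 : f * b ∈ N (j + 1) := by
          split_ifs at hb
          · exact (hk f hf).resolve_left (by simp) j b hb
          · exact hN f hf j b hb
        split_ifs
        · exact hle _ h1
        · exact h1
      · intro m j
        split_ifs
        · exact hF j
        · exact (hle j).trans (hF j)
      · intro m j
        split_ifs
        · exact le_rfl
        · omega
        · exact hle j
        · exact le_rfl
    obtain ⟨m0, hm0⟩ := H
    refine ⟨0, m0, fun j hj => ?_⟩
    have := hm0 (j + 1) (by omega) j
    rw [if_pos (by omega), if_neg (by omega)] at this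
    have h2 : N' j = N j := le_antisymm this (hle j)
    show ((plen z (N' j) (N j)).toNat : ℤ) = 0
    rw [h2, plen_self]
    rfl
  | cons x l ih =>
    intro N' N hN' hN hle hF hk hfin
    have hx : x ∈ fs := hl x (by simp)
    replace ih := ih (fun y hy => hl y (by simp [hy]))
    let μ : P →ₗ[O] P := LinearMap.mulLeft O x
    have hμ : ∀ b, μ b = x * b := fun b => rfl
    let K : ℕ → Submodule O P := fun j => N' j ⊓ (N (j + 1)).comap μ
    let C0 : ℕ → Submodule O P := fun j => match j with
      | 0 => ⊥
      | k + 1 => (N' k).map μ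
    let C : ℕ → Submodule O P := fun j => N j ⊔ C0 j
    have hCs : ∀ k, C (k + 1) = N (k + 1) ⊔ (N' k).map μ := fun k => rfl
    have hC0 : C 0 = N 0 ⊔ ⊥ := rfl
    have hNK : ∀ j, N j ≤ K j := fun j b hb => ⟨hle j hb, hN x hx j b hb⟩
    have hKN' : ∀ j, K j ≤ N' j := fun j => inf_le_left
    have hNC : ∀ j, N j ≤ C j := fun j => le_sup_left
    have hCN' : ∀ j, C j ≤ N' j := by
      intro j
      refine sup_le (hle j) ?_
      cases j with
      | zero => exact bot_le
      | succ k =>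
        show (N' k).map μ ≤ _
        rw [Submodule.map_le_iff_le_comap]
        intro b hb
        exact hN' x hx k b hb
    have hKs : Stab fs K := by
      intro f hf j b hb
      refine ⟨hN' f hf j b hb.1, ?_⟩
      show x * (f * b) ∈ N (j + 1 + 1)
      rw [mul_left_comm]
      exact hN f hf _ _ hb.2
    have hCst : Stab fs C := by
      intro f hf j b hb
      obtain ⟨a, ha, c, hc, rfl⟩ := Submodule.mem_sup.mp hb
      rw [mul_add]
      refine Submodule.add_mem _ (Submodule.mem_sup_left (hN f hf j a ha)) ?_
      cases j with
      | zero =>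
        rw [show c = 0 from (Submodule.mem_bot O).mp hc, mul_zero]
        exact zero_mem _
      | succ k =>
        obtain ⟨d, hd, rfl⟩ := hc
        refine Submodule.mem_sup_right ⟨f * d, hN' f hf k d hd, ?_⟩
        rw [hμ, hμ, mul_left_comm]
    have e1 : ∀ j, plen z (N' j) (N j) = plen z (N' j) (K j) + plen z (K j) (N j) :=
      fun j => plen_add z (hNK j) (hKN' j)
    have e2 : ∀ j, plen z (N' j) (N j) = plen z (N' j) (C j) + plen z (C j) (N j) :=
      fun j => plen_add z (hNC j) (hCN' j)
    have e3 : ∀ j, plen z (N' j) (K j) = plen z (C (j + 1)) (N (j + 1)) := by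
      intro j
      refine plen_map z (μ.domRestrict (N' j)) ?_ ?_ ?_
      · intro b
        exact Submodule.mem_sup_right ⟨b, b.2, rfl⟩
      · intro q hq
        obtain ⟨a, ha, c, ⟨b, hb, rfl⟩, rfl⟩ := Submodule.mem_sup.mp hq
        refine ⟨⟨b, hb⟩, ?_⟩
        show μ b - (a + μ b) ∈ _
        rw [show μ b - (a + μ b) = -a by ring]
        exact neg_mem ha
      · intro b
        exact ⟨fun h => ⟨b.2, h⟩, fun h => h.2⟩
    have fK : ∀ j, plen z (K j) (N j) ≠ ⊤ := fun j h => hfin j (by rw [e1, h, add_top])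
    have fC : ∀ j, plen z (N' j) (C j) ≠ ⊤ := fun j h => hfin j (by rw [e2, h, top_add])
    have hK := ih K N hKs hN hNK (fun j => (hKN' j).trans (hF j)) (by
      intro f hf
      rcases hk f hf with h | h
      · rcases List.mem_cons.mp h with rfl | h
        · right
          intro j b hb
          exact hb.2
        · exact Or.inl h
      · right
        intro j b hb
        exact h j b (hKN' j hb)) fK
    have hC := ih N' C hN' hCst hCN' hF (by
      intro f hf
      rcases hk f hf with h | h
      · rcases List.mem_cons.mp h with rfl | h
        · right
          intro j b hb
          exact Submodule.mem_sup_right ⟨b, hb, rfl⟩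
        · exact Or.inl h
      · right
        intro j b hb
        exact hNC _ (h j b hb)) fC
    refine EP.of_dif ?_
    convert EP.sub hC.shift hK using 1
    funext j
    simp only [dif, Pi.sub_apply]
    have g1 : (plen z (N' (j+1)) (N (j+1))).toNat =
        (plen z (N' (j+1)) (C (j+1))).toNat + (plen z (C (j+1)) (N (j+1))).toNat := by
      rw [e2]
      exact ENat.toNat_add (fC _) (fun h => hfin (j+1) (by rw [e2, h, add_top]))
    have g2 : (plen z (N' j) (N j)).toNat =
        (plen z (N' j) (K j)).toNat + (plen z (K j) (N j)).toNat := by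
      rw [e1]
      exact ENat.toNat_add (fun h => hfin j (by rw [e1, h, top_add])) (fK _)
    rw [e3] at g2
    push_cast [g1, g2]
    ring
end hilb

end PartA3

section PartA4
set_option linter.style.haveILetI false

/-- The graded algebra data used in the proof. -/
structure CoreData (O : Type u) [CommRing O] (P : Type u) [CommRing P] [Algebra O P]
    (A : Type u) [CommRing A] [Algebra O A] (t : O) (n : ℕ) where
  hA : Function.Surjective (algebraMap O A)
  hAker : ∀ o, algebraMap O A o = 0 → t ∣ o
  hAt : algebraMap O A t = 0
  B : ℕ → Submodule O P
  hB0 : ∀ b, b ∈ B 0 ↔ ∃ o, algebraMap O P o = b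
  hBmul : ∀ i j, ∀ a ∈ B i, ∀ b ∈ B j, a * b ∈ B (i + j)
  σ : P
  hσ : σ ∈ B n
  hσu : IsUnit σ
  hσdiv : ∀ j, ∀ b ∈ B (j + n), ∃ b' ∈ B j, b = σ * b'
  htP : ∀ p : P, t • p = 0 → p = 0
  ε : ∀ j, B j →ₗ[O] A
  hεmul : ∀ i j k, i + j = k → ∀ (a : B i) (b : B j) (c : B k), (c : P) = a * b →
    ε k c = ε i a * ε j b
  hε0 : ∀ o (c : B 0), (c : P) = algebraMap O P o → ε 0 c = algebraMap O A o
  hεker : ∀ j (b : B j), ε j b = 0 → ∃ b' ∈ B j, (b : P) = t • b'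
  hεσ : IsUnit (ε n ⟨σ, hσ⟩)

namespace CoreData
variable {O : Type u} [CommRing O] {P : Type u} [CommRing P] [Algebra O P]
    {A : Type u} [CommRing A] [Algebra O A] {t : O} {n : ℕ} (D : CoreData O P A t n)

lemma pow_mem {i : ℕ} {b : P} (hb : b ∈ D.B i) (k : ℕ) : b ^ k ∈ D.B (i * k) := by
  induction k with
  | zero => rw [mul_zero, pow_zero, D.hB0]; exact ⟨1, map_one _⟩
  | succ k ih => rw [mul_add, mul_one, pow_succ]; exact D.hBmul _ _ _ ih _ hb

lemma ε_pow {i : ℕ} (b : D.B i) (k : ℕ) : ∀ (m : ℕ), m = i * k → ∀ (c : D.B m),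
    (c : P) = (b : P) ^ k → D.ε m c = (D.ε i b) ^ k := by
  induction k with
  | zero =>
    intro m hm c hc
    rw [mul_zero] at hm
    subst hm
    rw [D.hε0 1 c (by rw [hc]; simp)]
    simp
  | succ k ih =>
    intro m hm c hc
    rw [D.hεmul (i * k) i m (by rw [hm]; ring) ⟨_, D.pow_mem b.2 k⟩ b c (by rw [hc, pow_succ]),
      ih _ rfl ⟨_, D.pow_mem b.2 k⟩ rfl, pow_succ]

lemma div_pow (j : ℕ) : ∀ b ∈ D.B (j * n), ∃ o, b = D.σ ^ j * algebraMap O P o := by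
  induction j with
  | zero =>
    intro b hb
    rw [zero_mul, D.hB0] at hb
    obtain ⟨o, rfl⟩ := hb
    exact ⟨o, by simp⟩
  | succ j ih =>
    intro b hb
    rw [add_mul, one_mul] at hb
    obtain ⟨b', hb', rfl⟩ := D.hσdiv _ _ hb
    obtain ⟨o, rfl⟩ := ih b' hb'
    exact ⟨o, by ring⟩

lemma pow_n {b : P} (hb : b ∈ D.B 1) : ∃ c, b ^ n = D.σ * algebraMap O P c ∧
    (D.ε 1 ⟨b, hb⟩) ^ n = D.ε n ⟨D.σ, D.hσ⟩ * algebraMap O A c := by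
  have h1 := D.pow_mem hb n
  rw [one_mul] at h1
  obtain ⟨c, hc⟩ := D.div_pow 1 _ (by rw [one_mul]; exact h1)
  rw [pow_one] at hc
  refine ⟨c, hc, ?_⟩
  have hc0 : algebraMap O P c ∈ D.B 0 := (D.hB0 _).mpr ⟨c, rfl⟩
  rw [← D.hε0 c ⟨_, hc0⟩ rfl, ← D.hεmul n 0 n (by simp) ⟨D.σ, D.hσ⟩ ⟨_, hc0⟩ ⟨_, h1⟩ hc,
    D.ε_pow ⟨b, hb⟩ n n (by simp) ⟨_, h1⟩ rfl]

lemma isUnit_of_ε [IsLocalRing O] (ht : t ∈ IsLocalRing.maximalIdeal O) (hn : 0 < n)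
    {b : P} (hb : b ∈ D.B 1)
    (hu : IsUnit (D.ε 1 ⟨b, hb⟩)) : IsUnit b := by
  obtain ⟨c, h1, h2⟩ := D.pow_n hb
  have h3 : IsUnit (algebraMap O A c) := by
    have := hu.pow n
    rw [h2] at this
    exact isUnit_of_mul_isUnit_right this
  have h4 : IsUnit c := by
    obtain ⟨a, ha⟩ := h3.exists_right_inv
    obtain ⟨o, rfl⟩ := D.hA a
    rw [← map_mul] at ha
    have : algebraMap O A (c * o - 1) = 0 := by rw [map_sub, ha, map_one, sub_self]
    have h5 := D.hAker _ this
    have h6 : c * o - 1 ∈ IsLocalRing.maximalIdeal O := by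
      obtain ⟨w, hw⟩ := h5
      rw [hw]
      exact Ideal.mul_mem_right _ _ ht
    have h7 : IsUnit (c * o) := by
      by_contra hcon
      have h8 : c * o ∈ IsLocalRing.maximalIdeal O := hcon
      have h9 := Ideal.sub_mem _ h8 h6
      rw [sub_sub_cancel] at h9
      exact (Ideal.ne_top_iff_one _).mp (IsLocalRing.maximalIdeal.isMaximal O).ne_top h9
    exact isUnit_of_mul_isUnit_left h7
  have h5 : IsUnit (b ^ n) := by
    rw [h1]
    exact D.hσu.mul (h4.map _)
  exact (isUnit_pow_iff hn.ne').mp h5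

/-- The set of elements `c` arising as `b ^ n / σ`. -/
def cset : Set O := {c | ∃ b ∈ D.B 1, b ^ n = D.σ * algebraMap O P c}

/-- The image of `B j`. -/
def I (j : ℕ) : Submodule O A := LinearMap.range (D.ε j)

lemma mul_mem_of_mem (D : CoreData O P A t n) (J : Submodule O A) {x : A} (hx : x ∈ J) (a : A) : a * x ∈ J := by
  obtain ⟨o, rfl⟩ := D.hA a
  rw [← Algebra.smul_def]
  exact J.smul_mem o hx

lemma I_zero : D.I 0 = ⊤ := by
  rw [eq_top_iff]
  intro a _
  obtain ⟨o, rfl⟩ := D.hA a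
  exact ⟨⟨_, (D.hB0 _).mpr ⟨o, rfl⟩⟩, D.hε0 o _ rfl⟩

lemma I_periodic (j : ℕ) : D.I (j + n) = D.I j := by
  apply le_antisymm
  · rintro _ ⟨b, rfl⟩
    obtain ⟨b', hb', h⟩ := D.hσdiv j b b.2
    rw [D.hεmul n j (j + n) (by ring) ⟨D.σ, D.hσ⟩ ⟨b', hb'⟩ b h]
    exact D.mul_mem_of_mem (D.I _) ⟨_, rfl⟩ _
  · rintro _ ⟨b, rfl⟩
    have h1 : D.σ * b ∈ D.B (j + n) := by
      rw [add_comm]; exact D.hBmul _ _ _ D.hσ _ b.2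
    have h2 := D.hεmul n j (j + n) (by ring) ⟨D.σ, D.hσ⟩ b ⟨_, h1⟩ rfl
    obtain ⟨w, hw⟩ := D.hεσ.exists_left_inv
    have : D.ε j b = w * D.ε (j + n) ⟨_, h1⟩ := by
      rw [h2, ← mul_assoc, hw, one_mul]
    rw [this]
    exact D.mul_mem_of_mem (D.I _) ⟨_, rfl⟩ _

/-- The ideal of `O` which is the preimage of `I 1`. -/
def Q : Ideal O := (D.I 1).comap (Algebra.linearMap O A)

lemma exists_not_mem {M : ℕ} (hM : t ^ M ∈ Ideal.span D.cset) {cs : Finset O}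
    (hcs : Ideal.span D.cset = Ideal.span (cs : Set O))
    {z : Ideal O} (hz : z ∈ D.Q.minimalPrimes) (p : Ideal O) (hp : p.IsPrime) (hpz : p < z) :
    ∃ c ∈ cs, c ∉ p := by
  by_contra hcon
  push Not at hcon
  have h1 : Ideal.span D.cset ≤ p := by
    rw [hcs, Ideal.span_le]; exact hcon
  have h2 : t ∈ p := hp.mem_of_pow_mem M (h1 hM)
  have h3 : D.Q ≤ p := by
    intro q hq
    obtain ⟨b, hb⟩ := hq
    obtain ⟨c, hc1, hc2⟩ := D.pow_n b.2
    have hc : c ∈ p := h1 (Ideal.subset_span ⟨b, b.2, hc1⟩)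
    obtain ⟨u0, hu0⟩ := D.hA (D.ε n ⟨D.σ, D.hσ⟩)
    have hb' : D.ε 1 ⟨(b : P), b.2⟩ = algebraMap O A q := hb
    rw [hb', ← hu0, ← map_pow, ← map_mul, ← sub_eq_zero, ← map_sub] at hc2
    obtain ⟨w, hw⟩ := D.hAker _ hc2
    have : q ^ n = t * w + u0 * c := by rw [← hw]; ring
    apply hp.mem_of_pow_mem n
    rw [this]
    exact p.add_mem (p.mul_mem_right _ h2) (p.mul_mem_left _ hc)
  exact hpz.not_ge (hz.2 ⟨hp, h3⟩ hpz.le)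

end CoreData

end PartA4

section PartA5
set_option linter.style.haveILetI false
lemma pow_split {R : Type*} [CommRing R] (x : R) {n n' : ℕ} (hn : n = n' + 1) :
    x ^ n = x ^ n' * x := by rw [hn, pow_succ]

namespace CoreData
variable {O : Type u} [CommRing O] {P : Type u} [CommRing P] [Algebra O P]
    {A : Type u} [CommRing A] [Algebra O A] {t : O} {n : ℕ} (D : CoreData O P A t n)

lemma F_le {fs : Finset P} (hfs : ∀ f ∈ fs, f ∈ D.B 1) (j : ℕ) :
    (Submodule.span O (fs : Set P)) ^ j ≤ D.B j := by
  induction j with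
  | zero =>
    intro b hb
    rw [pow_zero, Submodule.mem_one] at hb
    exact (D.hB0 b).mpr hb
  | succ j ih =>
    rw [pow_succ, Submodule.mul_le]
    intro a ha b hb
    have h1 : Submodule.span O (fs : Set P) ≤ D.B 1 := Submodule.span_le.mpr hfs
    exact D.hBmul _ _ _ (ih ha) _ (h1 hb)

lemma key_mul {n' : ℕ} (hn : n = n' + 1) {f : P} (hf : f ∈ D.B 1) {c : O}
    (hfc : f ^ n = D.σ * algebraMap O P c) {j : ℕ} {b : P} (hb : b ∈ D.B j) :
    ∃ o : O, b * f ^ (j * n') = D.σ ^ j * algebraMap O P o ∧ c ^ j • b = o • f ^ j := by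
  have h1 : b * f ^ (j * n') ∈ D.B (j * n) := by
    have := D.hBmul _ _ _ hb _ (D.pow_mem hf (j * n'))
    convert this using 2
    subst hn
    ring
  obtain ⟨o, ho⟩ := D.div_pow j _ h1
  refine ⟨o, ho, ?_⟩
  apply (D.hσu.pow j).mul_left_cancel
  rw [Algebra.smul_def, Algebra.smul_def, map_pow]
  calc D.σ ^ j * (algebraMap O P c ^ j * b) = (f ^ n) ^ j * b := by rw [hfc]; ring
    _ = (b * f ^ (j * n')) * f ^ j := by rw [pow_split f hn]; ring
    _ = _ := by rw [ho]; ring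

lemma B_fg [IsNoetherianRing O] {n' : ℕ} (hn : n = n' + 1) {M : ℕ}
    (hM : t ^ M ∈ Ideal.span D.cset) {cs : Finset O}
    (hcs : Ideal.span D.cset = Ideal.span (cs : Set O)) (g : O → P)
    (hg : ∀ c ∈ cs, g c ∈ D.B 1 ∧ g c ^ n = D.σ * algebraMap O P c) (j : ℕ) :
    IsNoetherian O (D.B j) := by
  let W : Submodule O P := Submodule.span O {D.σ ^ j}
  haveI : IsNoetherian O W := isNoetherian_span_of_finite O (Set.finite_singleton _)
  let Φ : D.B j →ₗ[O] (cs → W) := LinearMap.pi (fun c =>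
    ((LinearMap.mulRight O (g c ^ (j * n'))).domRestrict (D.B j)).codRestrict W (by
      intro b
      obtain ⟨o, ho, _⟩ := D.key_mul hn (hg c c.2).1 (hg c c.2).2 b.2
      show (b : P) * g c ^ (j * n') ∈ W
      rw [ho, mul_comm, ← Algebra.smul_def]
      exact W.smul_mem _ (Submodule.mem_span_singleton_self _)))
  refine isNoetherian_of_injective Φ ?_
  rw [injective_iff_map_eq_zero]
  intro b hb
  have h1 : ∀ c ∈ cs, c ^ j • (b : P) = 0 := by
    intro c hc
    have h2 : (b : P) * g c ^ (j * n') = 0 := congrArg Subtype.val (congrFun hb ⟨c, hc⟩)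
    apply (D.hσu.pow j).mul_left_cancel
    rw [mul_zero, Algebra.smul_def, map_pow]
    calc D.σ ^ j * (algebraMap O P c ^ j * b) = (g c ^ n) ^ j * b := by
          rw [(hg c hc).2]; ring
      _ = (b * g c ^ (j * n')) * g c ^ j := by rw [pow_split (g c) hn]; ring
      _ = 0 := by rw [h2, zero_mul]
  have h2 : Ideal.span D.cset ≤ Ideal.radical (LinearMap.ker (LinearMap.toSpanSingleton O P (b : P))) := by
    rw [hcs, Ideal.span_le]
    intro c hc
    exact ⟨j, h1 c hc⟩
  obtain ⟨k, hk⟩ := h2 hM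
  have h3 : (t ^ M) ^ k • (b : P) = 0 := hk
  rw [← pow_mul] at h3
  have h4 : ∀ m, t ^ m • (b : P) = 0 → (b : P) = 0 := by
    intro m
    induction m with
    | zero => intro h; simpa using h
    | succ m ih =>
      intro h
      rw [pow_succ', mul_smul] at h
      exact ih (D.htP _ h)
  exact Subtype.ext (h4 _ h3)

theorem exists_unit [IsLocalRing O] [IsNoetherianRing O] (ht : t ∈ IsLocalRing.maximalIdeal O)
    (hn : 0 < n) {M : ℕ} (hM : t ^ M ∈ Ideal.span D.cset) : ∃ b ∈ D.B 1, IsUnit b := by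
  classical
  by_contra hcon
  push Not at hcon
  have hnu : ∀ b (hb : b ∈ D.B 1), ¬ IsUnit (D.ε 1 ⟨b, hb⟩) :=
    fun b hb h => hcon b hb (D.isUnit_of_ε ht hn hb h)
  have hQ : D.Q ≠ ⊤ := by
    rw [Ideal.ne_top_iff_one]
    rintro ⟨b, hb⟩
    apply hnu b b.2
    change D.ε 1 b = algebraMap O A 1 at hb
    rw [hb, map_one]
    exact isUnit_one
  obtain ⟨z, hz⟩ := Ideal.nonempty_minimalPrimes hQ
  haveI hzp : z.IsPrime := hz.1.1
  have hfg : (Ideal.span D.cset).FG := (isNoetherianRing_iff_ideal_fg O).mp inferInstance _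
  obtain ⟨cs, hcsub, hcs⟩ := Submodule.fg_span_iff_fg_span_finset_subset _ |>.mp hfg
  have hcs' : Ideal.span D.cset = Ideal.span (cs : Set O) := hcs
  have hex : ∀ c ∈ cs, ∃ b, b ∈ D.B 1 ∧ b ^ n = D.σ * algebraMap O P c := by
    intro c hc
    obtain ⟨b, hb, hb'⟩ := hcsub hc
    exact ⟨b, hb, hb'⟩
  choose! g hg using hex
  let fs : Finset P := cs.image g
  have hfs : ∀ f ∈ fs, f ∈ D.B 1 := by
    intro f hf
    obtain ⟨c, hc, rfl⟩ := Finset.mem_image.mp hf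
    exact (hg c hc).1
  have hgfs : ∀ c ∈ cs, g c ∈ fs := fun c hc => Finset.mem_image_of_mem g hc
  have hnot := D.exists_not_mem hM hcs' hz
  obtain ⟨n', hn'⟩ : ∃ n', n = n' + 1 := ⟨n - 1, by omega⟩
  have hBfg := D.B_fg hn' hM hcs' g hg
  let F : ℕ → Submodule O P := fun j => (Submodule.span O (fs : Set P)) ^ j
  have hFB : ∀ j, F j ≤ D.B j := D.F_le hfs
  have hFs : Stab fs F := by
    intro f hf j b hb
    show f * b ∈ (Submodule.span O (fs : Set P)) ^ (j + 1)
    rw [pow_succ']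
    exact Submodule.mul_mem_mul (Submodule.subset_span hf) hb
  have hfpow : ∀ f ∈ fs, ∀ j, f ^ j ∈ F j := fun f hf j =>
    Submodule.pow_mem_pow _ (Submodule.subset_span hf) j
  have hcb : ∀ c ∈ cs, ∀ j, ∀ b ∈ D.B j, c ^ j • b ∈ F j := by
    intro c hc j b hb
    obtain ⟨o, _, h⟩ := D.key_mul hn' (hg c hc).1 (hg c hc).2 hb
    rw [h]
    exact (F j).smul_mem _ (hfpow _ (hgfs c hc) j)
  -- the images in A
  let E : ℕ → Submodule O A := fun j => ((F j).submoduleOf (D.B j)).map (D.ε j)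
  have hE : ∀ j (b : D.B j), (b : P) ∈ F j → D.ε j b ∈ E j := fun j b hb => ⟨b, hb, rfl⟩
  have hEI : ∀ j, E j ≤ D.I j := by
    rintro j _ ⟨b, _, rfl⟩
    exact ⟨b, rfl⟩
  have hEfin : ∀ j, plen z ⊤ (E j) ≠ ⊤ := by
    intro j
    haveI : Module.Finite O A := Module.Finite.of_surjective (Algebra.linearMap O A) D.hA
    refine plen_ne_top z Module.Finite.fg_top ?_
    intro p hp hpz
    obtain ⟨c, hc, hcp⟩ := hnot p hp hpz
    refine ⟨c ^ j, fun h => hcp (hp.mem_of_pow_mem j h), ?_⟩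
    intro x _
    have hb1 := (hg c hc).1
    have h1 : g c ^ j ∈ D.B j := by simpa using D.pow_mem hb1 j
    have h2 := D.ε_pow ⟨g c, hb1⟩ j j (by simp) ⟨_, h1⟩ rfl
    obtain ⟨c', h3, h4⟩ := D.pow_n hb1
    have h5 : algebraMap O P c' = algebraMap O P c :=
      D.hσu.mul_left_cancel (h3.symm.trans (hg c hc).2)
    have h6 : algebraMap O A c' = algebraMap O A c := by
      rw [← D.hε0 c' ⟨_, (D.hB0 _).mpr ⟨c', rfl⟩⟩ rfl, ← D.hε0 c ⟨_, (D.hB0 _).mpr ⟨c', rfl⟩⟩ h5]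
    rw [h6] at h4
    obtain ⟨w, hw⟩ := D.hεσ.exists_left_inv
    have h7 : c ^ j • x = (w ^ j * x * (D.ε 1 ⟨g c, hb1⟩) ^ (n' * j)) * D.ε j ⟨_, h1⟩ := by
      rw [h2, Algebra.smul_def, map_pow]
      have h8 : algebraMap O A c = w * (D.ε 1 ⟨g c, hb1⟩) ^ n := by
        rw [h4, ← mul_assoc, hw, one_mul]
      rw [h8, pow_split _ hn']
      ring
    rw [h7]
    exact D.mul_mem_of_mem (E j) (hE j ⟨_, h1⟩ (hfpow _ (hgfs c hc) j)) _
  let τ : P →ₗ[O] P := LinearMap.lsmul O P t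
  have hτ : ∀ b, τ b = t • b := fun b => rfl
  let tB : ℕ → Submodule O P := fun j => (D.B j).map τ
  let tF : ℕ → Submodule O P := fun j => (F j).map τ
  have htBB : ∀ j, tB j ≤ D.B j := by
    rintro j _ ⟨b, hb, rfl⟩
    exact (D.B j).smul_mem t hb
  have htFF : ∀ j, tF j ≤ F j := by
    rintro j _ ⟨b, hb, rfl⟩
    exact (F j).smul_mem t hb
  have htFB : ∀ j, tF j ≤ tB j := fun j => Submodule.map_mono (hFB j)
  have hεtB : ∀ j (b : D.B j), (b : P) ∈ tB j → D.ε j b = 0 := by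
    rintro j b ⟨b', hb', h⟩
    have : b = t • ⟨b', hb'⟩ := Subtype.ext h.symm
    rw [this, map_smul, Algebra.smul_def, D.hAt, zero_mul]
  -- lengths
  have L1 : ∀ j, plen z ⊤ (E j) = plen z ⊤ (D.I j) + plen z (D.I j) (E j) :=
    fun j => plen_add z (hEI j) le_top
  have L2 : ∀ j, plen z (D.B j) (F j ⊔ tB j) = plen z (D.I j) (E j) := by
    intro j
    refine plen_map z (D.ε j) (fun b => ⟨b, rfl⟩) ?_ ?_
    · rintro _ ⟨b, rfl⟩
      exact ⟨b, by rw [sub_self]; exact zero_mem _⟩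
    · intro b
      constructor
      · rintro ⟨b', hb', h⟩
        have h0 : D.ε j (b - b') = 0 := by rw [map_sub, h, sub_self]
        obtain ⟨d, hd, hd'⟩ := D.hεker j _ h0
        have : (b : P) = b' + t • d := by
          rw [← hd']; simp
        rw [this]
        exact Submodule.add_mem_sup hb' ⟨d, hd, rfl⟩
      · intro hb
        obtain ⟨x, hx, y, hy, hxy⟩ := Submodule.mem_sup.mp hb
        have : b = ⟨x, hFB j hx⟩ + ⟨y, htBB j hy⟩ := Subtype.ext hxy.symm
        rw [this, map_add, hεtB j ⟨y, htBB j hy⟩ hy, add_zero]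
        exact hE j _ hx
  have hBF : ∀ j, plen z (D.B j) (F j) ≠ ⊤ := by
    intro j
    haveI := hBfg j
    refine plen_ne_top z (Module.Finite.iff_fg.mp inferInstance) ?_
    intro p hp hpz
    obtain ⟨c, hc, hcp⟩ := hnot p hp hpz
    exact ⟨c ^ j, fun h => hcp (hp.mem_of_pow_mem j h), hcb c hc j⟩
  have L3 : ∀ j, plen z (D.B j) (F j) = plen z (D.B j) (F j ⊔ tB j) + plen z (F j ⊔ tB j) (F j) :=
    fun j => plen_add z le_sup_left (sup_le (hFB j) (htBB j))
  have L4 : ∀ j, plen z (tB j) (tF j) = plen z (tB j) (F j ⊓ tB j) + plen z (F j ⊓ tB j) (tF j) :=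
    fun j => plen_add z (le_inf (htFF j) (htFB j)) inf_le_right
  have L5 : ∀ j, plen z (tB j) (F j ⊓ tB j) = plen z (F j ⊔ tB j) (F j) := by
    intro j
    refine plen_map z (tB j).subtype ?_ ?_ ?_
    · intro b; exact Submodule.mem_sup_right b.2
    · intro q hq
      obtain ⟨x, hx, y, hy, rfl⟩ := Submodule.mem_sup.mp hq
      refine ⟨⟨y, hy⟩, ?_⟩
      show y - (x + y) ∈ _
      rw [show y - (x + y) = -x by ring]
      exact neg_mem hx
    · intro b
      exact ⟨fun h => ⟨h, b.2⟩, fun h => h.1⟩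
  have L6 : ∀ j, plen z (D.B j) (F j) = plen z (tB j) (tF j) := by
    intro j
    refine plen_map z (τ.domRestrict (D.B j)) ?_ ?_ ?_
    · intro b; exact ⟨b, b.2, rfl⟩
    · rintro _ ⟨b, hb, rfl⟩
      refine ⟨⟨b, hb⟩, ?_⟩
      show τ b - τ b ∈ _
      rw [sub_self]; exact zero_mem _
    · intro b
      constructor
      · rintro ⟨d, hd, h⟩
        have h0 : t • (d - (b : P)) = 0 := by
          rw [smul_sub, sub_eq_zero]; exact h
        have := D.htP _ h0
        rw [sub_eq_zero] at this
        rw [← this]; exact hd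
      · intro h; exact ⟨b, h, rfl⟩
  have L7 : ∀ j, plen z (D.B j) (F j ⊔ tB j) = plen z (F j ⊓ tB j) (tF j) := by
    intro j
    have h1 := L3 j
    rw [L6, L4, L5, add_comm] at h1
    have h2 : plen z (F j ⊔ tB j) (F j) ≠ ⊤ := fun h => hBF j (by rw [L3, h, add_top])
    exact ((ENat.add_left_injective_of_ne_top h2) h1).symm
  have hβfin : ∀ j, plen z (F j ⊓ tB j) (tF j) ≠ ⊤ := by
    intro j h
    exact hBF j (by rw [L3, L7, h, top_add])
  have hIfin : ∀ j, plen z ⊤ (D.I j) ≠ ⊤ := fun j h => hEfin j (by rw [L1, h, top_add])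
  -- beta
  have hβ : EP (fun j => ((plen z (F j ⊓ tB j) (tF j)).toNat : ℤ)) := by
    refine hilbert z fs fs.toList (fun x hx => by simpa using hx) _ _ ?_ ?_
      (fun j => le_inf (htFF j) (htFB j)) (fun j => inf_le_left)
      (fun f hf => Or.inl (by simpa using hf)) hβfin
    · rintro f hf j b ⟨hb, d, hd, rfl⟩
      refine ⟨hFs f hf j _ hb, f * d, ?_, ?_⟩
      · rw [add_comm]; exact D.hBmul _ _ _ (hfs f hf) _ hd
      · rw [hτ, hτ, mul_smul_comm]
    · rintro f hf j _ ⟨d, hd, rfl⟩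
      refine ⟨f * d, hFs f hf j d hd, ?_⟩
      rw [hτ, hτ, mul_smul_comm]
  -- alpha
  have hεf : ∀ f (hf : f ∈ fs) j (b : D.B j) (c : D.B (j + 1)), (c : P) = f * b →
      D.ε (j + 1) c = D.ε 1 ⟨f, hfs f hf⟩ * D.ε j b := by
    intro f hf j b c hc
    exact D.hεmul 1 j (j + 1) (by ring) ⟨f, hfs f hf⟩ b c hc
  have hEanti : ∀ j, E (j + 1) ≤ E j := by
    rintro j _ ⟨b, hb, rfl⟩
    have key : ∀ b ∈ F (j + 1), ∃ (h : b ∈ D.B (j + 1)), D.ε (j + 1) ⟨b, h⟩ ∈ E j := by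
      intro b hb
      change b ∈ (Submodule.span O (fs : Set P)) ^ (j + 1) at hb
      rw [pow_succ'] at hb
      refine Submodule.mul_induction_on hb ?_ ?_
      · intro x hx y hy
        have hyB : y ∈ D.B j := hFB j hy
        have hxB : x ∈ D.B 1 := (Submodule.span_le.mpr hfs) hx
        have h : x * y ∈ D.B (j + 1) := by
          rw [add_comm]; exact D.hBmul _ _ _ hxB _ hyB
        refine ⟨h, ?_⟩
        rw [D.hεmul 1 j (j + 1) (by ring) ⟨x, hxB⟩ ⟨y, hyB⟩ ⟨_, h⟩ rfl]
        exact D.mul_mem_of_mem (E j) (hE j ⟨y, hyB⟩ hy) _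
      · rintro x y ⟨hxB, hx⟩ ⟨hyB, hy⟩
        refine ⟨(D.B (j + 1)).add_mem hxB hyB, ?_⟩
        have e : (⟨x + y, (D.B (j + 1)).add_mem hxB hyB⟩ : D.B (j + 1)) =
          ⟨x, hxB⟩ + ⟨y, hyB⟩ := rfl
        rw [e, map_add]
        exact (E j).add_mem hx hy
    obtain ⟨_, h⟩ := key b hb
    exact h
  let G : ℕ → Submodule O P := fun j => F j ⊓ ((E (j + 1)).comap (D.ε j)).map (D.B j).subtype
  have L8 : ∀ j, plen z (F j) (G j) = plen z (E j) (E (j + 1)) := by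
    intro j
    refine plen_map z ((D.ε j).comp (Submodule.inclusion (hFB j))) ?_ ?_ ?_
    · intro b; exact hE j _ b.2
    · rintro _ ⟨b, hb, rfl⟩
      refine ⟨⟨b, hb⟩, ?_⟩
      show D.ε j b - D.ε j b ∈ _
      rw [sub_self]; exact zero_mem _
    · intro b
      constructor
      · intro h
        exact ⟨b.2, ⟨_, hFB j b.2⟩, h, rfl⟩
      · rintro ⟨_, ⟨c, hc, h⟩⟩
        have : Submodule.inclusion (hFB j) b = c := Subtype.ext h.symm
        show D.ε j _ ∈ _
        rw [this]; exact hc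
  have L9 : ∀ j, plen z ⊤ (E (j + 1)) = plen z ⊤ (E j) + plen z (E j) (E (j + 1)) :=
    fun j => plen_add z (hEanti j) le_top
  have hα' : EP (fun j => ((plen z (F j) (G j)).toNat : ℤ)) := by
    refine hilbert z fs fs.toList (fun x hx => by simpa using hx) _ _ hFs ?_
      (fun j => inf_le_left) (fun j => le_rfl)
      (fun f hf => Or.inl (by simpa using hf)) ?_
    · rintro f hf j _ ⟨hb, c, hc, rfl⟩
      have h1 : f * (c : P) ∈ D.B (j + 1) := by
        rw [add_comm]; exact D.hBmul _ _ _ (hfs f hf) _ c.2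
      refine ⟨hFs f hf j _ hb, ⟨_, h1⟩, ?_, rfl⟩
      show D.ε (j + 1) _ ∈ E (j + 1 + 1)
      rw [hεf f hf j c ⟨_, h1⟩ rfl]
      obtain ⟨d, hd, h2⟩ := hc
      rw [← h2]
      have h3 : f * (d : P) ∈ D.B (j + 1 + 1) := by
        rw [add_comm]; exact D.hBmul _ _ _ (hfs f hf) _ d.2
      rw [← hεf f hf (j + 1) d ⟨_, h3⟩ rfl]
      exact hE _ _ (hFs f hf (j + 1) _ hd)
    · intro j h
      rw [L8] at h
      exact hEfin (j + 1) (by rw [L9, h, add_top])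
  have hα : EP (fun j => ((plen z ⊤ (E j)).toNat : ℤ)) := by
    refine EP.of_dif ?_
    convert hα' using 1
    funext j
    have h1 : plen z (E j) (E (j + 1)) ≠ ⊤ := fun h => hEfin (j + 1) (by rw [L9, h, add_top])
    simp only [dif]
    rw [L9, L8, ENat.toNat_add (hEfin j) h1]
    push_cast
    ring
  have hlam : EP (fun j => ((plen z ⊤ (D.I j)).toNat : ℤ)) := by
    convert EP.sub hα hβ using 1
    funext j
    simp only [Pi.sub_apply]
    rw [L1, ← L2, L7, ENat.toNat_add (hIfin j) (hβfin j)]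
    push_cast
    ring
  have hconst := EP.const_of_periodic hn hlam (fun j => by simp only [D.I_periodic]) 1
  simp only [D.I_zero, plen_self] at hconst
  have h1 : plen z ⊤ (D.I 1) ≠ 0 := by
    refine plen_ne_zero z ⟨1, trivial, fun s hs => ?_⟩
    rw [← Algebra.algebraMap_eq_smul_one] at hs
    exact hz.1.2 hs
  have h2 : (plen z ⊤ (D.I 1)).toNat ≠ 0 := by
    rw [Ne, ENat.toNat_eq_zero]
    push Not
    exact ⟨h1, hIfin 1⟩
  apply h2
  exact_mod_cast hconst
end CoreData

end PartA5

section PartB1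
set_option linter.style.haveILetI false

section depth
variable {A : Type u} [CommRing A] [IsNoetherianRing A] {κ : Type u} (h : κ → A)
  {E : Type u} [AddCommGroup E] [Module A E] (e0 : E)

/-- Elementwise form of depth at least two along the common zero locus of `h`. -/
def DepthTwo {A : Type u} [CommRing A] {κ : Type u} (h : κ → A) : Prop :=
  ∀ p : Ideal A, p.IsPrime → (∀ k, h k ∈ p) → ∃ r1 ∈ p, ∃ r2 ∈ p,
    (∀ a, r1 * a = 0 → ∃ s ∉ p, s * a = 0) ∧
    (∀ a b, r2 * a = r1 * b → ∃ s ∉ p, ∃ c, s * a = r1 * c)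

lemma depth_inj (hd : DepthTwo h)
    (h3 : ∀ a : A, a • e0 = 0 → ∀ k, ∃ M, h k ^ M * a = 0) :
    ∀ a : A, a • e0 = 0 → a = 0 := by
  intro a ha
  by_contra hne
  obtain ⟨p, hp, hle⟩ := exists_le_isAssociatedPrime_of_isNoetherianRing A
    (⟨a, ha⟩ : LinearMap.ker (LinearMap.toSpanSingleton A E e0)) (by
      intro h; exact hne (congrArg Subtype.val h))
  obtain ⟨hpp, x, hx⟩ := isAssociatedPrime_iff.mp hp
  have hx' : ∀ s : A, s ∈ p ↔ s * (x : A) = 0 := by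
    intro s
    rw [hx, Submodule.mem_colon_singleton, Submodule.mem_bot]
    exact ⟨fun h => congrArg Subtype.val h, fun h => Subtype.ext h⟩
  have hk : ∀ k, h k ∈ p := by
    intro k
    obtain ⟨M, hM⟩ := h3 x x.2 k
    exact hpp.mem_of_pow_mem M ((hx' _).mpr hM)
  obtain ⟨r1, hr1, r2, hr2, H1, H2⟩ := hd p hpp hk
  obtain ⟨s, hs, hs'⟩ := H1 x ((hx' _).mp hr1)
  exact hs ((hx' _).mpr hs')

lemma depth_ext [Finite κ] (hd : DepthTwo h)
    (h3 : ∀ a : A, a • e0 = 0 → ∀ k, ∃ M, h k ^ M * a = 0)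
    (h1 : ∀ e : E, ∀ k, ∃ M, ∃ a : A, h k ^ M • e = a • e0)
    (h2 : ∀ e : E, (∀ k, ∃ M, h k ^ M • e = 0) → e = 0) :
    ∀ e : E, ∃ a : A, e = a • e0 := by
  classical
  haveI := Fintype.ofFinite κ
  have hinj := depth_inj h e0 hd h3
  intro e
  by_contra hne
  let N : Submodule A E := Submodule.span A {e0}
  have hN : ∀ x : E, x ∈ N ↔ ∃ a : A, x = a • e0 := by
    intro x
    rw [Submodule.mem_span_singleton]
    exact ⟨fun ⟨a, h⟩ => ⟨a, h.symm⟩, fun ⟨a, h⟩ => ⟨a, h.symm⟩⟩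
  obtain ⟨p, hp, hle⟩ := exists_le_isAssociatedPrime_of_isNoetherianRing A
    (Submodule.Quotient.mk e : E ⧸ N) (by
      rw [Ne, Submodule.Quotient.mk_eq_zero, hN]; exact hne)
  obtain ⟨hpp, x, hx⟩ := isAssociatedPrime_iff.mp hp
  obtain ⟨f, rfl⟩ := Submodule.Quotient.mk_surjective _ x
  have hx' : ∀ s : A, s ∈ p ↔ ∃ a : A, s • f = a • e0 := by
    intro s
    rw [← hN, hx, ← Submodule.Quotient.mk_eq_zero N, Submodule.mem_colon_singleton,
      Submodule.mem_bot, Submodule.Quotient.mk_smul]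
  have hk : ∀ k, h k ∈ p := by
    intro k
    obtain ⟨M, a, hM⟩ := h1 f k
    exact hpp.mem_of_pow_mem M ((hx' _).mpr ⟨a, hM⟩)
  obtain ⟨r1, hr1, r2, hr2, H1, H2⟩ := hd p hpp hk
  obtain ⟨a1, ha1⟩ := (hx' _).mp hr1
  obtain ⟨a2, ha2⟩ := (hx' _).mp hr2
  have h4 : r2 * a1 = r1 * a2 := by
    rw [← sub_eq_zero]
    apply hinj
    rw [sub_smul, mul_smul, mul_smul, ← ha1, ← ha2, smul_comm, sub_self]
  obtain ⟨s, hs, c, hc⟩ := H2 _ _ h4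
  let g : E := s • f - c • e0
  have hg : r1 • g = 0 := by
    show r1 • (s • f - c • e0) = 0
    rw [smul_sub, smul_comm, ha1, smul_smul, smul_smul, hc, sub_self]
  choose M a ha using fun k => h1 g k
  have hra : ∀ k, r1 * a k = 0 := by
    intro k
    apply hinj
    rw [mul_smul, ← ha, smul_comm, hg, smul_zero]
  choose s' hs' hsa using fun k => H1 _ (hra k)
  have hprod : (∏ k, s' k) ∉ p := by
    intro hmem
    obtain ⟨k, _, hk⟩ := (Ideal.IsPrime.prod_mem_iff (hp := hpp)).mp hmem
    exact hs' k hk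
  have hz : (∏ k, s' k) • g = 0 := by
    apply h2
    intro k
    refine ⟨M k, ?_⟩
    rw [smul_comm, ha, smul_smul, ← Finset.prod_erase_mul _ _ (Finset.mem_univ k), mul_assoc, hsa,
      mul_zero, zero_smul]
  have : (∏ k, s' k) * s ∈ p := by
    rw [hx']
    refine ⟨(∏ k, s' k) * c, ?_⟩
    rw [mul_smul, mul_smul, ← sub_eq_zero, ← smul_sub]
    exact hz
  rcases hpp.mem_or_mem this with h | h
  · exact hprod h
  · exact hs h
end depth

/-- Depth at least two: existence of a weakly regular sequence of length two, elementwise. -/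
lemma depthTwo_of_loc {A : Type u} [CommRing A] (p : Ideal A) [p.IsPrime] (S : Type u) [CommRing S]
    [IsLocalRing S] [Algebra A S] [IsLocalization.AtPrime S p]
    (hS : ∃ rs : List S, rs.length = 2 ∧ (∀ r ∈ rs, r ∈ IsLocalRing.maximalIdeal S) ∧
      RingTheory.Sequence.IsWeaklyRegular S rs) :
    ∃ r1 ∈ p, ∃ r2 ∈ p,
    (∀ a, r1 * a = 0 → ∃ s ∉ p, s * a = 0) ∧
    (∀ a b, r2 * a = r1 * b → ∃ s ∉ p, ∃ c, s * a = r1 * c) := by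
  obtain ⟨rs, hl, hm, hreg⟩ := hS
  obtain ⟨x, y, rfl⟩ := List.length_eq_two.mp hl
  have hx := hm x (by simp)
  have hy := hm y (by simp)
  have hregx : ∀ a : S, x * a = 0 → a = 0 := by
    have := (RingTheory.Sequence.isWeaklyRegular_cons_iff S x [y]).mp hreg
    intro a ha
    exact isSMulRegular_iff_right_eq_zero_of_smul.mp this.1 a ha
  have hregy : ∀ a b : S, y * a = x * b → ∃ c, a = x * c := by
    have h1 := (RingTheory.Sequence.isWeaklyRegular_cons_iff S x [y]).mp hreg
    have h2 := (RingTheory.Sequence.isWeaklyRegular_cons_iff _ y []).mp h1.2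
    intro a b hab
    have h3 := mem_of_isSMulRegular_quotient_of_smul_mem h2.1 (x := a) (by
      rw [Submodule.mem_smul_pointwise_iff_exists]
      exact ⟨b, trivial, hab.symm⟩)
    rw [Submodule.mem_smul_pointwise_iff_exists] at h3
    obtain ⟨c, _, hc⟩ := h3
    exact ⟨c, hc.symm⟩
  obtain ⟨⟨x1, u⟩, hx1⟩ := IsLocalization.surj p.primeCompl x
  obtain ⟨⟨y1, v⟩, hy1⟩ := IsLocalization.surj p.primeCompl y
  dsimp only at hx1 hy1
  have hu := IsLocalization.map_units S u
  have hv := IsLocalization.map_units S v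
  refine ⟨x1, ?_, y1, ?_, ?_, ?_⟩
  · rw [← IsLocalization.AtPrime.to_map_mem_maximal_iff S p, ← hx1]
    exact Ideal.mul_mem_right _ _ hx
  · rw [← IsLocalization.AtPrime.to_map_mem_maximal_iff S p, ← hy1]
    exact Ideal.mul_mem_right _ _ hy
  · intro a ha
    have h1 : x * (algebraMap A S u * algebraMap A S a) = 0 := by
      rw [← mul_assoc, hx1, ← map_mul, ha, map_zero]
    have h2 := hregx _ h1
    rw [hu.mul_right_eq_zero] at h2
    obtain ⟨s, hs⟩ := (IsLocalization.map_eq_zero_iff p.primeCompl S a).mp h2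
    exact ⟨s, s.2, hs⟩
  · intro a b hab
    have h1 : y * (algebraMap A S v * algebraMap A S a) =
        x * (algebraMap A S u * algebraMap A S b) := by
      rw [← mul_assoc, hy1, ← mul_assoc, hx1, ← map_mul, ← map_mul, hab]
    obtain ⟨c, hc⟩ := hregy _ _ h1
    obtain ⟨⟨c1, w⟩, hc1⟩ := IsLocalization.surj p.primeCompl c
    dsimp only at hc1
    have h2 : algebraMap A S (v * u * w * a) = algebraMap A S (x1 * c1) := by
      simp only [map_mul]
      rw [← hc1, ← hx1]
      linear_combination (algebraMap A S u * algebraMap A S w) * hc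
    obtain ⟨s, hs⟩ := IsLocalization.exists_of_eq (M := p.primeCompl) h2
    refine ⟨s * (v * u * w), ?_, s * c1, ?_⟩
    · exact (s * (v * u * w)).2
    · linear_combination hs

end PartB1

section PartC1
set_option linter.style.haveILetI false
open AlgebraicGeometry CategoryTheory Opposite TopologicalSpace LineBundleOn

section basics
variable {X Y : Scheme.{u}}

lemma resS_resS {U V W : X.Opens} (h1 : W ≤ V) (h2 : V ≤ U) (a : Γ(X, U)) :
    resS X h1 (resS X h2 a) = resS X (h1.trans h2) a := by
  show (X.presheaf.map (homOfLE h1).op) ((X.presheaf.map (homOfLE h2).op) a) = _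
  rw [← CommRingCat.comp_apply, ← Functor.map_comp, ← op_comp, homOfLE_comp]
  rfl

lemma resS_self {U : X.Opens} (h : U ≤ U) (a : Γ(X, U)) : resS X h a = a := by
  show (X.presheaf.map (homOfLE h).op) a = a
  rw [show homOfLE h = 𝟙 _ from rfl, op_id, CategoryTheory.Functor.map_id]; rfl

lemma coe_resU {U V : X.Opens} (h : V ≤ U) (a : (Γ(X, U))ˣ) :
    ((resU X h a : (Γ(X, V))ˣ) : Γ(X, V)) = resS X h (a : Γ(X, U)) := rfl

/-- Pull-back of sections. -/
def mapS (f : Y ⟶ X) {U : X.Opens} {W : Y.Opens} (e : W ≤ f ⁻¹ᵁ U) :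
    ↥Γ(X, U) →+* ↥Γ(Y, W) := (f.appLE U W e).hom

lemma coe_mapU (f : Y ⟶ X) {U : X.Opens} {W : Y.Opens} (e : W ≤ f ⁻¹ᵁ U) (a : (Γ(X, U))ˣ) :
    ((mapU f e a : (Γ(Y, W))ˣ) : Γ(Y, W)) = mapS f e (a : Γ(X, U)) := rfl

lemma resS_mapS (f : Y ⟶ X) {U : X.Opens} {W W' : Y.Opens} (e : W ≤ f ⁻¹ᵁ U)
    (h : W' ≤ W) (u : Γ(X, U)) :
    resS Y h (mapS f e u) = mapS f (h.trans e) u := by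
  show (Y.presheaf.map (homOfLE h).op) ((f.appLE U W e) u) = (f.appLE U W' _) u
  rw [← CommRingCat.comp_apply, Scheme.Hom.appLE_map]

lemma mapS_resS (f : Y ⟶ X) {U U' : X.Opens} {W : Y.Opens} (hU : U' ≤ U)
    (e : W ≤ f ⁻¹ᵁ U') (e' : W ≤ f ⁻¹ᵁ U) (u : Γ(X, U)) :
    mapS f e (resS X hU u) = mapS f e' u := by
  show (f.appLE U' W e) ((X.presheaf.map (homOfLE hU).op) u) = (f.appLE U W e') u
  rw [← CommRingCat.comp_apply, Scheme.Hom.map_appLE]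

lemma resS_isLoc {W W' : X.Opens} (hW : IsAffineOpen W) (g : Γ(X, ⊤))
    (hW' : W' = W ⊓ X.basicOpen g) (h : W' ≤ W) :
    @IsLocalization.Away _ _ (resS X le_top g : Γ(X, W)) Γ(X, W') _ (resS X h).toAlgebra := by
  refine hW.isLocalization_of_eq_basicOpen (resS X le_top g : Γ(X, W)) (homOfLE h) ?_
  rw [hW']
  exact (X.basicOpen_res g (homOfLE (le_top : W ≤ ⊤)).op).symm

lemma T1 {W W' : X.Opens} (hW : IsAffineOpen W) (g : Γ(X, ⊤))
    (hW' : W' = W ⊓ X.basicOpen g) (h : W' ≤ W) (a : Γ(X, W)) (ha : resS X h a = 0) :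
    ∃ n, (resS X le_top g) ^ n * a = 0 := by
  letI := (resS X h).toAlgebra
  haveI := resS_isLoc hW g hW' h
  have ha' : algebraMap Γ(X, W) Γ(X, W') a = algebraMap Γ(X, W) Γ(X, W') 0 := by
    rw [map_zero]; exact ha
  obtain ⟨⟨_, n, rfl⟩, hc⟩ :=
    (IsLocalization.eq_iff_exists (Submonoid.powers (resS X le_top g : Γ(X, W))) _).mp ha'
  exact ⟨n, by simpa using hc⟩

lemma T2 {W W' : X.Opens} (hW : IsAffineOpen W) (g : Γ(X, ⊤))
    (hW' : W' = W ⊓ X.basicOpen g) (h : W' ≤ W) (x : Γ(X, W')) :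
    ∃ n, ∃ y : Γ(X, W), resS X h y = (resS X le_top g) ^ n * x := by
  letI := (resS X h).toAlgebra
  haveI := resS_isLoc hW g hW' h
  obtain ⟨⟨y, ⟨_, n, rfl⟩⟩, hc⟩ :=
    IsLocalization.surj (Submonoid.powers (resS X le_top g : Γ(X, W))) x
  refine ⟨n, y, ?_⟩
  have h1 : resS X h y = x * resS X h ((resS X le_top g) ^ n) := hc.symm
  rw [h1, map_pow, resS_resS, mul_comm]

lemma T3 {W : X.Opens} (g : Γ(X, ⊤)) (hW : W ≤ X.basicOpen g) :
    IsUnit (resS X le_top g : Γ(X, W)) := by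
  have h : IsUnit (resS X le_top g : Γ(X, X.basicOpen g)) :=
    RingedSpace.isUnit_res_basicOpen _ g
  have := h.map (resS X hW)
  rwa [resS_resS] at this

end basics

end PartC1

section PartC2
set_option linter.style.haveILetI false
open AlgebraicGeometry CategoryTheory Opposite TopologicalSpace LineBundleOn

/-- Sections over an open as an algebra over global sections. -/
@[reducible] def secAlg {X : Scheme.{u}} (W : X.Opens) : Algebra Γ(X, ⊤) Γ(X, W) :=
  (resS X le_top).toAlgebra

/-- Families of sections. -/
abbrev Fam {X : Scheme.{u}} {κ : Type u} (W : κ → X.Opens) : Type u := ∀ k, Γ(X, W k)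

/-- The algebra structure on families of sections. -/
@[reducible] def famAlg {X : Scheme.{u}} {κ : Type u} (W : κ → X.Opens) :
    Algebra Γ(X, ⊤) (Fam W) :=
  @Pi.algebra κ Γ(X, ⊤) (fun k => Γ(X, W k)) _ _ (fun k => secAlg (W k))

section fam
attribute [local instance] famAlg
variable {X : Scheme.{u}} {κ : Type u} (W : κ → X.Opens)

lemma fam_smul (a : Γ(X, ⊤)) (m : Fam W) (k : κ) : (a • m) k = resS X le_top a * m k := rfl

lemma fam_alg (a : Γ(X, ⊤)) (k : κ) : algebraMap Γ(X, ⊤) (Fam W) a k = resS X le_top a := rfl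

/-- Global sections of the `j`-th power of the line bundle with cocycle `u`. -/
def Bm (u : ∀ k l, (Γ(X, W k ⊓ W l))ˣ) (j : ℕ) : Submodule Γ(X, ⊤) (Fam W) where
  carrier := {m | ∀ k l, resS X inf_le_left (m k) =
    (u k l : Γ(X, W k ⊓ W l)) ^ j * resS X inf_le_right (m l)}
  zero_mem' k l := by simp
  add_mem' {a b} ha hb k l := by
    rw [Pi.add_apply, Pi.add_apply, map_add, map_add, ha k l, hb k l]; ring
  smul_mem' c a ha k l := by
    rw [fam_smul, fam_smul, map_mul, map_mul, ha k l, resS_resS, resS_resS]; ring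

variable {W}
variable {u : ∀ k l, (Γ(X, W k ⊓ W l))ˣ}

lemma mem_Bm {j : ℕ} {m : Fam W} : m ∈ Bm W u j ↔ ∀ k l, resS X inf_le_left (m k) =
    (u k l : Γ(X, W k ⊓ W l)) ^ j * resS X inf_le_right (m l) := Iff.rfl

lemma Bm_mul {i j : ℕ} {a b : Fam W} (ha : a ∈ Bm W u i) (hb : b ∈ Bm W u j) :
    a * b ∈ Bm W u (i + j) := by
  intro k l
  rw [Pi.mul_apply, Pi.mul_apply, map_mul, map_mul, ha k l, hb k l]; ring

lemma Bm_alg (o : Γ(X, ⊤)) : algebraMap Γ(X, ⊤) (Fam W) o ∈ Bm W u 0 := by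
  intro k l
  rw [fam_alg, fam_alg, resS_resS, resS_resS]; simp

lemma Bm_div {j n : ℕ} {s : Fam W} (hs : s ∈ Bm W u n) (hsu : IsUnit s) {b : Fam W}
    (hb : b ∈ Bm W u (j + n)) : ∃ b' ∈ Bm W u j, b = s * b' := by
  obtain ⟨s, rfl⟩ := hsu
  refine ⟨(↑s⁻¹ : Fam W) * b, ?_, by rw [← mul_assoc, Units.mul_inv, one_mul]⟩
  intro k l
  have h1 : ∀ k, (s : Fam W) k * (↑s⁻¹ : Fam W) k = 1 := fun k => by
    rw [← Pi.mul_apply, Units.mul_inv]; rfl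
  have hk := congrArg (resS X (inf_le_left : W k ⊓ W l ≤ W k)) (h1 k)
  have hl := congrArg (resS X (inf_le_right : W k ⊓ W l ≤ W l)) (h1 l)
  rw [map_mul, map_one] at hk hl
  rw [Pi.mul_apply, Pi.mul_apply, map_mul, map_mul]
  have h2 := hb k l
  have h3 := hs k l
  rw [h3] at hk
  rw [h2, pow_add]
  generalize resS X _ ((↑s⁻¹ : Fam W) k) = x at *
  generalize resS X _ ((↑s⁻¹ : Fam W) l) = y at *
  generalize resS X _ ((s : Fam W) l) = z at *
  linear_combination (u k l : Γ(X, W k ⊓ W l)) ^ j * resS X inf_le_right (b l) * y * hk -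
     (u k l : Γ(X, W k ⊓ W l)) ^ j * resS X inf_le_right (b l) * x * (u k l : Γ(X, W k ⊓ W l)) ^ n * hl

variable [IsAffine X] {g : κ → Γ(X, ⊤)} (hW : ∀ k, W k = X.basicOpen (g k))

lemma aff1 (hW : ∀ k, W k = X.basicOpen (g k)) (k : κ) : IsAffineOpen (W k) := by
  rw [hW]; exact (isAffineOpen_top X).basicOpen _

lemma aff2 (hW : ∀ k, W k = X.basicOpen (g k)) (k l : κ) : IsAffineOpen (W k ⊓ W l) := by
  rw [hW, hW, ← X.basicOpen_mul]; exact (isAffineOpen_top X).basicOpen _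

/-- A uniform exponent over a finite type. -/
lemma unif {α : Type u} [Finite α] (p : α → ℕ → Prop) (hp : ∀ a n m, n ≤ m → p a n → p a m)
    (h : ∀ a, ∃ n, p a n) : ∃ n, ∀ a, p a n := by
  classical
  haveI := Fintype.ofFinite α
  choose n hn using h
  exact ⟨∑ a, n a, fun a => hp a _ _ (Finset.single_le_sum (f := n) (fun _ _ => Nat.zero_le _)
    (Finset.mem_univ a)) (hn a)⟩

/-- A compatible family becomes global after multiplication with a power of `g k`. -/
lemma fam_h1 [Finite κ] (hW : ∀ k, W k = X.basicOpen (g k)) {e : Fam W} (he : e ∈ Bm W u 0)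
    (k : κ) : ∃ M, ∃ a : Γ(X, ⊤), g k ^ M • e = algebraMap Γ(X, ⊤) (Fam W) a := by
  obtain ⟨n, a, ha⟩ := T2 (isAffineOpen_top X) (g k) (W' := W k) (by rw [hW]; simp) le_top (e k)
  obtain ⟨N, hN⟩ := unif (fun l N => (resS X le_top (g k)) ^ N *
      ((resS X le_top (g k)) ^ n * e l - resS X (le_top : W l ≤ ⊤) a) = 0)
    (by
      intro l i j hij h
      obtain ⟨d, rfl⟩ := Nat.exists_eq_add_of_le hij
      rw [add_comm, pow_add, mul_assoc, h, mul_zero])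
    (by
      intro l
      refine T1 (aff1 hW l) (g k) (W' := W l ⊓ W k) (by rw [hW k]) inf_le_left _ ?_
      have h1 := he l k
      rw [pow_zero, one_mul] at h1
      rw [map_sub, map_mul, map_pow, resS_resS, resS_resS, h1]
      have h2 := congrArg (resS X (inf_le_right : W l ⊓ W k ≤ W k)) ha
      rw [resS_resS, map_mul, map_pow, resS_resS] at h2
      rw [h2, sub_self])
  refine ⟨N + n, g k ^ N * a, ?_⟩
  funext l
  rw [fam_smul, fam_alg, map_mul, map_pow, map_pow, pow_add]
  linear_combination hN l

/-- A family killed by powers of all `g k` is zero. -/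
lemma fam_h2 (hW : ∀ k, W k = X.basicOpen (g k)) {e : Fam W}
    (he : ∀ k, ∃ M, g k ^ M • e = 0) : e = 0 := by
  funext k
  obtain ⟨M, hM⟩ := he k
  have h1 := congrFun hM k
  rw [fam_smul, map_pow] at h1
  exact ((T3 (g k) (hW k).le).pow M).mul_right_eq_zero.mp h1

lemma fam_h3 (hW : ∀ k, W k = X.basicOpen (g k)) {a : Γ(X, ⊤)}
    (ha : algebraMap Γ(X, ⊤) (Fam W) a = 0) (k : κ) : ∃ M, g k ^ M * a = 0 := by
  obtain ⟨n, hn⟩ := T1 (isAffineOpen_top X) (g k) (W' := W k) (by rw [hW]; simp) le_top a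
    (congrFun ha k)
  refine ⟨n, ?_⟩
  rwa [resS_self] at hn

/-- Extension of a section over one member of the cover. -/
lemma fam_ext [Finite κ] (hW : ∀ k, W k = X.basicOpen (g k))
    (hu : ∀ l m k, resS X (inf_le_left : W l ⊓ W m ⊓ W k ≤ W l ⊓ W m) (u l m) *
      resS X (le_inf (inf_le_left.trans inf_le_right) inf_le_right : _ ≤ W m ⊓ W k) (u m k) =
      resS X (le_inf (inf_le_left.trans inf_le_left) inf_le_right : _ ≤ W l ⊓ W k) (u l k))
    (k : κ) : ∃ b ∈ Bm W u 1, IsUnit (b k) := by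
  obtain ⟨n, hn⟩ := unif (fun l n => ∃ y : Γ(X, W l),
      resS X (inf_le_left : W l ⊓ W k ≤ W l) y = (resS X le_top (g k)) ^ n * (u l k : Γ(X, W l ⊓ W k)))
    (by
      rintro l i j hij ⟨y, hy⟩
      obtain ⟨d, rfl⟩ := Nat.exists_eq_add_of_le hij
      refine ⟨resS X le_top (g k) ^ d * y, ?_⟩
      rw [map_mul, map_pow, resS_resS, hy]; ring)
    (fun l => T2 (aff1 hW l) (g k) (W' := W l ⊓ W k) (by rw [hW k]) inf_le_left _)
  choose y hy using hn
  obtain ⟨N, hN⟩ := unif (fun p : κ × κ => fun N => resS X le_top (g k) ^ N *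
      (resS X (inf_le_left : W p.1 ⊓ W p.2 ≤ W p.1) (y p.1) -
        (u p.1 p.2 : Γ(X, W p.1 ⊓ W p.2)) * resS X (inf_le_right : W p.1 ⊓ W p.2 ≤ W p.2) (y p.2)) = 0)
    (by
      intro l i j hij h
      obtain ⟨d, rfl⟩ := Nat.exists_eq_add_of_le hij
      rw [add_comm, pow_add, mul_assoc, h, mul_zero])
    (by
      rintro ⟨l, m⟩
      refine T1 (aff2 hW l m) (g k) (W' := W l ⊓ W m ⊓ W k) (by rw [hW k]) inf_le_left _ ?_
      have h1 := congrArg (resS X (le_inf (inf_le_left.trans inf_le_left) inf_le_right :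
        W l ⊓ W m ⊓ W k ≤ W l ⊓ W k)) (hy l)
      have h2 := congrArg (resS X (le_inf (inf_le_left.trans inf_le_right) inf_le_right :
        W l ⊓ W m ⊓ W k ≤ W m ⊓ W k)) (hy m)
      rw [resS_resS, map_mul, map_pow, resS_resS] at h1 h2
      rw [map_sub, map_mul, resS_resS, resS_resS, h1, h2, ← hu l m k]
      ring)
  refine ⟨fun l => resS X le_top (g k) ^ N * y l, ?_, ?_⟩
  · intro l m
    have := hN (l, m)
    rw [map_mul, map_mul, map_pow, map_pow, resS_resS, resS_resS, pow_one]
    linear_combination this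
  · refine IsUnit.mul ((T3 (g k) (hW k).le).pow N) ?_
    have h1 := congrArg (resS X (le_inf le_rfl le_rfl : W k ≤ W k ⊓ W k)) (hy k)
    rw [resS_resS, resS_self, map_mul, map_pow, resS_resS] at h1
    rw [h1]
    exact ((T3 (g k) (hW k).le).pow n).mul ((u k k).isUnit.map _)

end fam

end PartC2

section PartC3
set_option linter.style.haveILetI false
open AlgebraicGeometry CategoryTheory Opposite TopologicalSpace LineBundleOn

section fam2
attribute [local instance] famAlg

section one
variable {X : Scheme.{u}} {κ : Type u} {W : κ → X.Opens}
  {u : ∀ k l, (Γ(X, W k ⊓ W l))ˣ} [IsAffine X] {g : κ → Γ(X, ⊤)}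

lemma fam_inj [IsNoetherianRing Γ(X, ⊤)] (hW : ∀ k, W k = X.basicOpen (g k)) (hd : DepthTwo g) :
    ∀ a, algebraMap Γ(X, ⊤) (Fam W) a = 0 → a = 0 := by
  intro a ha
  refine depth_inj g (1 : Fam W) hd ?_ a (by rw [← Algebra.algebraMap_eq_smul_one, ha])
  intro a ha
  exact fam_h3 hW (by rw [Algebra.algebraMap_eq_smul_one, ha])

lemma fam_exists [Finite κ] [IsNoetherianRing Γ(X, ⊤)] (hW : ∀ k, W k = X.basicOpen (g k))
    (hd : DepthTwo g) {e : Fam W} (he : e ∈ Bm W u 0) :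
    ∃ a, algebraMap Γ(X, ⊤) (Fam W) a = e := by
  have h1mem : (1 : Fam W) ∈ Bm W u 0 := by
    have := Bm_alg (W := W) (u := u) 1
    rwa [map_one] at this
  suffices key : ∃ a : Γ(X, ⊤), (⟨e, he⟩ : Bm W u 0) = a • ⟨1, h1mem⟩ by
    obtain ⟨a, ha⟩ := key
    refine ⟨a, ?_⟩
    rw [Algebra.algebraMap_eq_smul_one]
    exact (congrArg Subtype.val ha).symm
  refine depth_ext g (⟨1, h1mem⟩ : Bm W u 0) hd ?_ ?_ ?_ ⟨e, he⟩
  · intro a ha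
    exact fam_h3 hW (by rw [Algebra.algebraMap_eq_smul_one]; exact congrArg Subtype.val ha)
  · rintro ⟨e, he⟩ k
    obtain ⟨M, a, h⟩ := fam_h1 hW he k
    refine ⟨M, a, Subtype.ext ?_⟩
    rw [Algebra.algebraMap_eq_smul_one] at h
    exact h
  · rintro ⟨e, he⟩ h
    refine Subtype.ext (fam_h2 hW fun k => ?_)
    obtain ⟨M, hM⟩ := h k
    exact ⟨M, congrArg Subtype.val hM⟩

lemma T5 {W : X.Opens} {g : Γ(X, ⊤)} (hW : W = X.basicOpen g) {t : Γ(X, ⊤)}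
    (ht : ∀ a, t * a = 0 → a = 0) (x : Γ(X, W)) (hx : resS X le_top t * x = 0) : x = 0 := by
  obtain ⟨n, y, hy⟩ := T2 (isAffineOpen_top X) g (W' := W) (by rw [hW]; simp) le_top x
  obtain ⟨m, hm⟩ := T1 (isAffineOpen_top X) g (W' := W) (by rw [hW]; simp) le_top (t * y) (by
    rw [map_mul, hy]; linear_combination (resS X le_top g) ^ n * hx)
  rw [resS_self] at hm
  have h1 : g ^ m * y = 0 := ht _ (by linear_combination hm)
  have h2 := congrArg (resS X (le_top : W ≤ ⊤)) h1
  rw [map_mul, hy, map_pow, map_zero, ← mul_assoc, ← pow_add] at h2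
  exact ((T3 g hW.le).pow _).mul_right_eq_zero.mp h2

lemma T6 {W : X.Opens} {g : Γ(X, ⊤)} (hW : W = X.basicOpen g) {c : Γ(X, ⊤)}
    (hc : IsUnit (resS X (le_top : W ≤ ⊤) c)) : ∃ N, c ∣ g ^ N := by
  obtain ⟨v, hv⟩ := hc.exists_right_inv
  obtain ⟨n, y, hy⟩ := T2 (isAffineOpen_top X) g (W' := W) (by rw [hW]; simp) le_top v
  obtain ⟨m, hm⟩ := T1 (isAffineOpen_top X) g (W' := W) (by rw [hW]; simp) le_top
    (c * y - g ^ n) (by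
      rw [map_sub, map_mul, hy, map_pow]; linear_combination (resS X le_top g) ^ n * hv)
  rw [resS_self] at hm
  exact ⟨m + n, g ^ m * y, by rw [pow_add]; linear_combination -hm⟩

end one

section two
variable {X X0 : Scheme.{u}} {κ : Type u} {W : κ → X.Opens}
  {u : ∀ k l, (Γ(X, W k ⊓ W l))ˣ} [IsAffine X] [IsAffine X0] {g : κ → Γ(X, ⊤)}
  {f : X0 ⟶ X}

/-- Global pull back. -/
def glob (f : X0 ⟶ X) : Γ(X, ⊤) →+* Γ(X0, ⊤) := mapS f (by simp : (⊤ : X0.Opens) ≤ f ⁻¹ᵁ ⊤)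

lemma glob_res (f : X0 ⟶ X) {U : X.Opens} {W0 : X0.Opens} (e : W0 ≤ f ⁻¹ᵁ U) (a : Γ(X, ⊤)) :
    mapS f e (resS X le_top a) = resS X0 le_top (glob f a) := by
  have h1 := mapS_resS f (le_top : U ≤ ⊤) e (show W0 ≤ f ⁻¹ᵁ ⊤ from by simp) a
  have h2 := resS_mapS f (by simp : (⊤ : X0.Opens) ≤ f ⁻¹ᵁ ⊤) (le_top : W0 ≤ ⊤) a
  exact h1.trans h2.symm

lemma hW0 (f : X0 ⟶ X) (hW : ∀ k, W k = X.basicOpen (g k)) (k : κ) :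
    f ⁻¹ᵁ W k = X0.basicOpen (glob f (g k)) := by
  rw [hW, Scheme.preimage_basicOpen_top]
  congr 1
  simp only [glob, mapS, Scheme.Hom.appLE, Scheme.Hom.appTop]
  rw [show (homOfLE _ : (⊤ : X0.Opens) ⟶ f ⁻¹ᵁ ⊤) = 𝟙 _ from rfl]
  erw [CategoryTheory.Functor.map_id]
  rfl

lemma T4 (f : X0 ⟶ X) {t : Γ(X, ⊤)} (hAker : ∀ o, glob f o = 0 → t ∣ o)
    {W : X.Opens} {g : Γ(X, ⊤)} (hW : W = X.basicOpen g)
    (x : Γ(X, W)) (hx : mapS f (le_refl (f ⁻¹ᵁ W)) x = 0) :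
    ∃ x', x = resS X le_top t * x' := by
  have hW0' : f ⁻¹ᵁ W = X0.basicOpen (glob f g) :=
    hW0 (κ := PUnit) (W := fun _ => W) (g := fun _ => g) f (fun _ => hW) ⟨⟩
  obtain ⟨n, y, hy⟩ := T2 (isAffineOpen_top X) g (W' := W) (by rw [hW]; simp) le_top x
  have h1 := congrArg (mapS f (le_refl (f ⁻¹ᵁ W))) hy
  rw [glob_res, map_mul, hx, mul_zero] at h1
  obtain ⟨m, hm⟩ := T1 (isAffineOpen_top X0) (glob f g) (W' := f ⁻¹ᵁ W)
    (by rw [hW0']; simp) le_top _ h1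
  rw [resS_self, ← map_pow, ← map_mul] at hm
  obtain ⟨z, hz⟩ := hAker _ hm
  have h2 := congrArg (resS X (le_top : W ≤ ⊤)) hz
  rw [map_mul, hy, map_pow, map_mul, ← mul_assoc, ← pow_add] at h2
  obtain ⟨v, hv⟩ := ((T3 g hW.le).pow (m + n)).exists_left_inv
  exact ⟨v * resS X le_top z, by linear_combination v * h2 - x * hv⟩

/-- The twisted pull back of families. -/
def mapFam (f : X0 ⟶ X) (s0 : ∀ k, (Γ(X0, f ⁻¹ᵁ W k))ˣ) (j : ℕ) (b : Fam W) :
    Fam (fun k => f ⁻¹ᵁ W k) :=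
  fun k => mapS f (le_refl (f ⁻¹ᵁ W k)) (b k) * ((s0 k)⁻¹ : (Γ(X0, f ⁻¹ᵁ W k))ˣ) ^ j

lemma mapFam_mem {s0 : ∀ k, (Γ(X0, f ⁻¹ᵁ W k))ˣ}
    (hs0 : ∀ k l, mapU f (preimage_inf_le f (W k) (W l)) (u k l) =
      resU X0 inf_le_left (s0 k) * (resU X0 inf_le_right (s0 l))⁻¹)
    {j : ℕ} {b : Fam W} (hb : b ∈ Bm W u j) :
    mapFam f s0 j b ∈ Bm (fun k => f ⁻¹ᵁ W k) (fun _ _ => 1) 0 := by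
  intro k l
  have h1 := congrArg (mapS f (preimage_inf_le f (W k) (W l))) (hb k l)
  rw [map_mul, map_pow, ← coe_mapU, hs0] at h1
  rw [mapS_resS _ _ _ (inf_le_left : f ⁻¹ᵁ W k ⊓ f ⁻¹ᵁ W l ≤ _),
    mapS_resS _ _ _ (inf_le_right : f ⁻¹ᵁ W k ⊓ f ⁻¹ᵁ W l ≤ _)] at h1
  rw [pow_zero, one_mul]
  simp only [mapFam]
  rw [map_mul, map_mul, resS_mapS, resS_mapS, h1, map_pow, map_pow, ← coe_resU, ← coe_resU,
    map_inv, map_inv]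
  generalize resU X0 _ (s0 k) = a
  generalize resU X0 _ (s0 l) = b
  rw [Units.val_mul, mul_pow]
  have : (a : Γ(X0, f ⁻¹ᵁ W k ⊓ f ⁻¹ᵁ W l)) ^ j * (a⁻¹ : _ˣ) ^ j = 1 := by
    rw [← mul_pow, Units.mul_inv, one_pow]
  linear_combination (b⁻¹ : _ˣ) ^ j * mapS f _ _ * this

end two
end fam2

end PartC3

section PartC4
set_option linter.style.haveILetI false
open AlgebraicGeometry CategoryTheory Opposite TopologicalSpace LineBundleOn

section fam3
attribute [local instance] famAlg

set_option maxHeartbeats 1000000 in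
theorem core_scheme {X X0 : Scheme.{u}} {κ : Type u} [Finite κ] {W : κ → X.Opens}
    {u : ∀ k l, (Γ(X, W k ⊓ W l))ˣ} [IsAffine X] [IsAffine X0] {g : κ → Γ(X, ⊤)}
    {f : X0 ⟶ X} (hW : ∀ k, W k = X.basicOpen (g k))
    (hu : ∀ l m k, resS X (inf_le_left : W l ⊓ W m ⊓ W k ≤ W l ⊓ W m) (u l m) *
      resS X (le_inf (inf_le_left.trans inf_le_right) inf_le_right : _ ≤ W m ⊓ W k) (u m k) =
      resS X (le_inf (inf_le_left.trans inf_le_left) inf_le_right : _ ≤ W l ⊓ W k) (u l k))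
    [IsLocalRing Γ(X, ⊤)] [IsNoetherianRing Γ(X, ⊤)] [IsNoetherianRing Γ(X0, ⊤)]
    {t : Γ(X, ⊤)} (htm : t ∈ IsLocalRing.maximalIdeal Γ(X, ⊤))
    (htz : ∀ a, t * a = 0 → a = 0)
    (hsurj : Function.Surjective (glob f)) (hker : ∀ o, glob f o = 0 → t ∣ o)
    (ht0 : glob f t = 0)
    (htg : t ∈ (Ideal.span (Set.range g)).radical)
    (hd : DepthTwo (fun k => glob f (g k)))
    {s0 : ∀ k, (Γ(X0, f ⁻¹ᵁ W k))ˣ}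
    (hs0 : ∀ k l, mapU f (preimage_inf_le f (W k) (W l)) (u k l) =
      resU X0 inf_le_left (s0 k) * (resU X0 inf_le_right (s0 l))⁻¹)
    {n : ℕ} (hn : 0 < n) {s : ∀ k, (Γ(X, W k))ˣ}
    (hs : ∀ k l, u k l ^ n = resU X inf_le_left (s k) * (resU X inf_le_right (s l))⁻¹) :
    ∃ b ∈ Bm W u 1, IsUnit b := by
  have hinj := fam_inj (hW0 f hW) hd
  have hex := fun (e : Fam (fun k => f ⁻¹ᵁ W k)) he =>
    fam_exists (u := fun _ _ => 1) (hW0 f hW) hd (e := e) he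
  letI : Algebra Γ(X, ⊤) Γ(X0, ⊤) := (glob f).toAlgebra
  have hinj' : Function.Injective (algebraMap Γ(X0, ⊤) (Fam (fun k => f ⁻¹ᵁ W k))) :=
    (injective_iff_map_eq_zero _).mpr hinj
  -- multiplication by `t` is injective on families
  have htP : ∀ p : Fam W, t • p = 0 → p = 0 := by
    intro p hp
    funext k
    exact T5 (hW k) htz _ (congrFun hp k)
  -- degree zero
  have hB0 : ∀ b, b ∈ Bm W u 0 ↔ ∃ o, algebraMap Γ(X, ⊤) (Fam W) o = b := by
    intro m
    constructor
    swap
    · rintro ⟨o, rfl⟩; exact Bm_alg o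
    intro hm
    let J : Ideal Γ(X, ⊤) := (LinearMap.range (Algebra.linearMap Γ(X, ⊤) (Fam W))).comap
      (LinearMap.toSpanSingleton Γ(X, ⊤) (Fam W) m)
    have hJ : ∀ o, o ∈ J ↔ ∃ a, algebraMap Γ(X, ⊤) (Fam W) a = o • m := fun o => Iff.rfl
    have h1 : Ideal.span (Set.range g) ≤ J.radical := by
      rw [Ideal.span_le]
      rintro _ ⟨k, rfl⟩
      obtain ⟨M, a, h⟩ := fam_h1 hW hm k
      exact ⟨M, (hJ _).mpr ⟨a, h.symm⟩⟩
    obtain ⟨N, hN⟩ := (Ideal.radical_mono h1).trans (Ideal.radical_idem J).le htg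
    rw [hJ] at hN
    clear h1
    clear_value J
    clear hJ
    induction N with
    | zero =>
      obtain ⟨a, ha⟩ := hN
      exact ⟨a, by rw [ha, pow_zero, one_smul]⟩
    | succ N ih =>
      obtain ⟨a, ha⟩ := hN
      have h2 : glob f a = 0 := by
        apply hinj
        funext k
        have h3 := congrArg (mapS f (le_refl (f ⁻¹ᵁ W k))) (congrFun ha k)
        rw [fam_alg, fam_smul, map_mul, glob_res, glob_res, map_pow, ht0, zero_pow (by omega),
          map_zero, zero_mul] at h3
        rw [fam_alg, h3]; rfl
      obtain ⟨a', rfl⟩ := hker _ h2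
      refine ih ⟨a', ?_⟩
      rw [← sub_eq_zero]
      apply htP
      rw [smul_sub, smul_smul, ← pow_succ', ← ha, map_mul, Algebra.smul_def, sub_self]
  -- the trivialisation
  let σ : Fam W := fun k => (s k : Γ(X, W k))
  have hσ : σ ∈ Bm W u n := by
    intro k l
    show resS X inf_le_left (s k : Γ(X, W k)) = _ * resS X inf_le_right (s l : Γ(X, W l))
    rw [← coe_resU, ← coe_resU, ← Units.val_pow_eq_pow_val, hs k l, ← Units.val_mul]
    simp
  have hσu : IsUnit σ := by
    rw [Pi.isUnit_iff]; exact fun k => (s k).isUnit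
  choose ev hev using fun (j : ℕ) (b : Bm W u j) => hex _ (mapFam_mem hs0 b.2)
  have hevk : ∀ j (b : Bm W u j) k, resS X0 le_top (ev j b) =
      mapS f (le_refl (f ⁻¹ᵁ W k)) (b.1 k) *
        (((s0 k)⁻¹ : (Γ(X0, f ⁻¹ᵁ W k))ˣ) : Γ(X0, f ⁻¹ᵁ W k)) ^ j :=
    fun j b k => congrFun (hev j b) k
  have hevext : ∀ a b : Γ(X0, ⊤), (∀ k, resS X0 (le_top : f ⁻¹ᵁ W k ≤ ⊤) a = resS X0 le_top b) →
      a = b := fun a b h => hinj' (funext h)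
  let D : CoreData Γ(X, ⊤) (Fam W) Γ(X0, ⊤) t n :=
    { hA := hsurj
      hAker := hker
      hAt := ht0
      B := Bm W u
      hB0 := hB0
      hBmul := fun i j a ha b hb => Bm_mul ha hb
      σ := σ
      hσ := hσ
      hσu := hσu
      hσdiv := fun j b hb => Bm_div hσ hσu hb
      htP := htP
      ε := fun j =>
        { toFun := ev j
          map_add' := by
            intro a b
            apply hevext
            intro k
            rw [map_add, hevk, hevk, hevk, Submodule.coe_add, Pi.add_apply, map_add, add_mul]
          map_smul' := by
            intro o b
            apply hevext
            intro k
            rw [RingHom.id_apply, Algebra.smul_def, map_mul, hevk, hevk, Submodule.coe_smul,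
              fam_smul, map_mul, glob_res, mul_assoc]
            rfl }
      hεmul := by
        rintro i j k rfl a b c h
        apply hevext
        intro k
        show resS X0 le_top (ev _ c) = resS X0 le_top (ev i a * ev j b)
        rw [map_mul, hevk, hevk, hevk, h, Pi.mul_apply, map_mul, pow_add]
        ring
      hε0 := by
        intro o c h
        apply hevext
        intro k
        show resS X0 le_top (ev _ c) = resS X0 le_top (glob f o)
        rw [hevk, h, fam_alg, glob_res, pow_zero, mul_one]
      hεker := by
        intro j b hb
        have h1 : ∀ k, ∃ x' : Γ(X, W k), b.1 k = resS X le_top t * x' := by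
          intro k
          refine T4 f hker (hW k) _ ?_
          have h2 := hevk j b k
          rw [show ev j b = 0 from hb, map_zero] at h2
          exact (((s0 k)⁻¹.isUnit.pow j).mul_left_eq_zero).mp h2.symm
        choose x' hx' using h1
        refine ⟨x', ?_, funext hx'⟩
        intro k l
        rw [← sub_eq_zero]
        refine T5 (g := g k * g l) (by rw [X.basicOpen_mul, hW, hW]) htz _ ?_
        have h3 := b.2 k l
        rw [hx', hx', map_mul, map_mul, resS_resS, resS_resS] at h3
        linear_combination h3
      hεσ := by
        have hmem := mapFam_mem hs0 hσ
        have hun : IsUnit (mapFam f s0 n σ) := by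
          rw [Pi.isUnit_iff]
          intro k
          exact ((s k).isUnit.map _).mul ((s0 k)⁻¹.isUnit.pow n)
        obtain ⟨e, he, h1⟩ := Bm_div (j := 0) hmem hun (b := 1) (by
          have := Bm_alg (W := fun k => f ⁻¹ᵁ W k) (u := fun _ _ => 1) 1
          rwa [map_one] at this)
        obtain ⟨a, ha⟩ := hex e he
        refine IsUnit.of_mul_eq_one a ?_
        apply hinj'
        rw [map_mul, map_one, ha, h1]
        congr 1
        exact hev n ⟨σ, hσ⟩ }
  have hg : ∀ k, g k ∈ (Ideal.span D.cset).radical := by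
    intro k
    obtain ⟨b, hb, hbu⟩ := fam_ext hW hu k
    have hbn : b ^ n ∈ D.B (0 + n) := by
      have := D.pow_mem hb n
      rw [one_mul] at this
      exact (congrArg (fun i => b ^ n ∈ D.B i) (zero_add n)).mpr this
    obtain ⟨b', hb', h1⟩ := D.hσdiv 0 _ hbn
    obtain ⟨c, rfl⟩ := (D.hB0 _).mp hb'
    have hc : c ∈ D.cset := ⟨b, hb, h1⟩
    have h2 := congrFun h1 k
    rw [Pi.pow_apply, Pi.mul_apply, fam_alg] at h2
    obtain ⟨N, hN⟩ := T6 (hW k) (c := c) (isUnit_of_mul_isUnit_right (h2 ▸ hbu.pow n))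
    exact ⟨N, Ideal.mem_of_dvd _ hN (Ideal.subset_span hc)⟩
  have hle : Ideal.span (Set.range g) ≤ (Ideal.span D.cset).radical := by
    rw [Ideal.span_le]; rintro _ ⟨k, rfl⟩; exact hg k
  obtain ⟨M, hM⟩ := (Ideal.radical_mono hle).trans (Ideal.radical_idem _).le htg
  exact D.exists_unit htm hn hM

end fam3

end PartC4

section PartC5
set_option linter.style.haveILetI false
open AlgebraicGeometry CategoryTheory Opposite TopologicalSpace LineBundleOn

section glue
variable {X : Scheme.{u}} {κ : Type u}

lemma resS_ext {U : X.Opens} {W : κ → X.Opens} (hle : ∀ k, W k ≤ U)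
    (hc : U ≤ iSup W) {a b : Γ(X, U)} (h : ∀ k, resS X (hle k) a = resS X (hle k) b) : a = b :=
  X.sheaf.eq_of_locally_eq' W U (fun k => homOfLE (hle k)) hc a b h

lemma resU_ext {U : X.Opens} {W : κ → X.Opens} (hle : ∀ k, W k ≤ U)
    (hc : U ≤ iSup W) {a b : (Γ(X, U))ˣ} (h : ∀ k, resU X (hle k) a = resU X (hle k) b) :
    a = b :=
  Units.ext (resS_ext hle hc fun k => congrArg Units.val (h k))

lemma glueS {U : X.Opens} {W : κ → X.Opens} (hle : ∀ k, W k ≤ U)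
    (hc : U ≤ iSup W) (sf : ∀ k, Γ(X, W k))
    (h : ∀ k l, resS X (inf_le_left : W k ⊓ W l ≤ W k) (sf k) = resS X inf_le_right (sf l)) :
    ∃ s : Γ(X, U), ∀ k, resS X (hle k) s = sf k :=
  (X.sheaf.existsUnique_gluing' W U (fun k => homOfLE (hle k)) hc sf h).exists

lemma glueU {U : X.Opens} {W : κ → X.Opens} (hle : ∀ k, W k ≤ U)
    (hc : U ≤ iSup W) (sf : ∀ k, (Γ(X, W k))ˣ)
    (h : ∀ k l, resU X (inf_le_left : W k ⊓ W l ≤ W k) (sf k) = resU X inf_le_right (sf l)) :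
    ∃ s : (Γ(X, U))ˣ, ∀ k, resU X (hle k) s = sf k := by
  obtain ⟨a, ha⟩ := glueS hle hc (fun k => (sf k : Γ(X, W k)))
    (fun k l => congrArg Units.val (h k l))
  obtain ⟨b, hb⟩ := glueS hle hc (fun k => (((sf k)⁻¹ : (Γ(X, W k))ˣ) : Γ(X, W k)))
    (fun k l => by
      have := congrArg (fun x => ((x⁻¹ : (Γ(X, W k ⊓ W l))ˣ) : Γ(X, W k ⊓ W l))) (h k l)
      simp only [← map_inv] at this
      exact this)
  have hab : a * b = 1 := resS_ext hle hc fun k => by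
    rw [map_mul, ha, hb, map_one, Units.mul_inv]
  exact ⟨⟨a, b, hab, by rw [mul_comm, hab]⟩, fun k => Units.ext (ha k)⟩

end glue

section final
attribute [local instance] famAlg

lemma trivial_of_unit {X : Scheme.{u}} {V : X.Opens} (L : LineBundleOn X V) {κ : Type u}
    {W : κ → X.Opens} (i : κ → L.ι) (hle : ∀ k, W k ≤ L.U (i k)) (hc : V ≤ iSup W)
    (b : ∀ k, (Γ(X, W k))ˣ)
    (hb : ∀ k l, resU X inf_le_left (b k) =
      resU X (inf_le_inf (hle k) (hle l)) (L.t (i k) (i l)) * resU X inf_le_right (b l)) :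
    L.IsTrivial := by
  have hcov : ∀ U : X.Opens, U ≤ V → U ≤ ⨆ k, U ⊓ W k := by
    intro U hU
    rw [← inf_iSup_eq]
    exact le_inf le_rfl (hU.trans hc)
  have key : ∀ j, ∃ s : (Γ(X, L.U j))ˣ, ∀ k,
      resU X (inf_le_left : L.U j ⊓ W k ≤ L.U j) s =
        resU X (inf_le_inf le_rfl (hle k)) (L.t j (i k)) * resU X inf_le_right (b k) := by
    intro j
    refine glueU _ (hcov _ (L.le j)) _ ?_
    intro k l
    have e1 : L.U j ⊓ W k ⊓ (L.U j ⊓ W l) ≤ W k ⊓ W l := inf_le_inf inf_le_right inf_le_right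
    have h1 := congrArg (resU X e1) (hb k l)
    have hj : L.U j ⊓ W k ⊓ (L.U j ⊓ W l) ≤ L.U j := inf_le_left.trans inf_le_left
    have hk : L.U j ⊓ W k ⊓ (L.U j ⊓ W l) ≤ L.U (i k) :=
      inf_le_left.trans (inf_le_right.trans (hle k))
    have hl : L.U j ⊓ W k ⊓ (L.U j ⊓ W l) ≤ L.U (i l) :=
      inf_le_right.trans (inf_le_right.trans (hle l))
    have h2 := L.cocycle_res j (i k) (i l) (le_inf (le_inf hj hk) hl) (le_inf hj hk)
      (le_inf hk hl) (le_inf hj hl)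
    rw [map_mul, resU_resU, resU_resU, resU_resU] at h1
    rw [map_mul, map_mul, resU_resU, resU_resU, resU_resU, resU_resU, h1, ← mul_assoc, h2]
  choose s hs using key
  refine ⟨s, fun j m => ?_⟩
  refine resU_ext (W := fun k => L.U j ⊓ L.U m ⊓ W k) (fun k => inf_le_left)
    (hcov _ (inf_le_left.trans (L.le j))) ?_
  intro k
  have e1 : L.U j ⊓ L.U m ⊓ W k ≤ L.U j ⊓ W k := inf_le_inf inf_le_left le_rfl
  have e2 : L.U j ⊓ L.U m ⊓ W k ≤ L.U m ⊓ W k := inf_le_inf inf_le_right le_rfl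
  have h1 := congrArg (resU X e1) (hs j k)
  have h2 := congrArg (resU X e2) (hs m k)
  have hj : L.U j ⊓ L.U m ⊓ W k ≤ L.U j := inf_le_left.trans inf_le_left
  have hm : L.U j ⊓ L.U m ⊓ W k ≤ L.U m := inf_le_left.trans inf_le_right
  have hk : L.U j ⊓ L.U m ⊓ W k ≤ L.U (i k) := inf_le_right.trans (hle k)
  have h3 := L.cocycle_res j m (i k) (le_inf (le_inf hj hm) hk) (le_inf hj hm)
      (le_inf hm hk) (le_inf hj hk)
  rw [map_mul, resU_resU, resU_resU, resU_resU] at h1 h2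
  rw [map_mul, map_inv, resU_resU, resU_resU, h1, h2, ← h3]
  rw [eq_mul_inv_iff_mul_eq, mul_assoc]

theorem scheme_main {X X0 : Scheme.{u}} [IsAffine X] [IsAffine X0]
    {f : X0 ⟶ X}
    [IsLocalRing Γ(X, ⊤)] [IsNoetherianRing Γ(X, ⊤)] [IsNoetherianRing Γ(X0, ⊤)]
    {t : Γ(X, ⊤)} (htm : t ∈ IsLocalRing.maximalIdeal Γ(X, ⊤))
    (htz : ∀ a, t * a = 0 → a = 0)
    (hsurj : Function.Surjective (glob f)) (hker : ∀ o, glob f o = 0 → t ∣ o)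
    (ht0 : glob f t = 0)
    {V : X.Opens} (hVc : IsCompact (V : Set X))
    (hd : ∀ (κ : Type u) (g : κ → Γ(X, ⊤)), V ≤ ⨆ k, X.basicOpen (g k) →
      DepthTwo (fun k => glob f (g k)))
    (htg : ∀ (κ : Type u) (g : κ → Γ(X, ⊤)), V ≤ ⨆ k, X.basicOpen (g k) →
      t ∈ (Ideal.span (Set.range g)).radical)
    (L : LineBundleOn X V) (htriv0 : (LineBundleOn.pullback f L).IsTrivial)
    (n : ℕ) (hn : 0 < n) (htors : (L.pow n).IsTrivial) : L.IsTrivial := by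
  classical
  have h1 : ∀ x : V, ∃ i, ∃ g : Γ(X, ⊤), X.basicOpen g ≤ L.U i ∧ (x : X) ∈ X.basicOpen g := by
    intro x
    obtain ⟨i, hi⟩ := L.covers x x.2
    obtain ⟨g, hg1, hg2⟩ := (isAffineOpen_top X).exists_basicOpen_le (V := L.U i) ⟨x, hi⟩ trivial
    exact ⟨i, g, hg1, hg2⟩
  choose i g hg hx using h1
  obtain ⟨F, hF⟩ := hVc.elim_finite_subcover (fun x : V => (X.basicOpen (g x) : Set X))
    (fun x => (X.basicOpen (g x)).isOpen) (fun x hxV => Set.mem_iUnion.mpr ⟨⟨x, hxV⟩, hx ⟨x, hxV⟩⟩)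
  let κ : Type u := {x : V // x ∈ F}
  let g' : κ → Γ(X, ⊤) := fun k => g k.1
  let W : κ → X.Opens := fun k => X.basicOpen (g' k)
  have hc : V ≤ iSup W := by
    intro x hxV
    obtain ⟨y, hy⟩ := Set.mem_iUnion.mp (hF hxV)
    obtain ⟨hyF, hy⟩ := Set.mem_iUnion.mp hy
    exact Opens.mem_iSup.mpr ⟨⟨y, hyF⟩, hy⟩
  have hle : ∀ k : κ, W k ≤ L.U (i k.1) := fun k => hg k.1
  obtain ⟨s00, hs00⟩ : ∃ s : ∀ i, (Γ(X0, f ⁻¹ᵁ L.U i))ˣ, ∀ i j,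
    mapU f (preimage_inf_le f (L.U i) (L.U j)) (L.t i j) =
      resU X0 inf_le_left (s i) * (resU X0 inf_le_right (s j))⁻¹ := by
    exact htriv0
  obtain ⟨sn, hsn⟩ : ∃ s : ∀ i, (Γ(X, L.U i))ˣ, ∀ i j,
    L.t i j ^ n = resU X inf_le_left (s i) * (resU X inf_le_right (s j))⁻¹ := by
    exact htors
  have hpre : ∀ k : κ, f ⁻¹ᵁ W k ≤ f ⁻¹ᵁ L.U (i k.1) := fun k x hx => hle k hx
  obtain ⟨b, hb, hbu⟩ := core_scheme (X := X) (X0 := X0) (κ := κ) (W := W) (g := g') (f := f)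
    (u := fun k l => resU X (inf_le_inf (hle k) (hle l)) (L.t (i k.1) (i l.1)))
    (fun k => rfl)
    (by
      intro l m k
      have e1 : W l ⊓ W m ⊓ W k ≤ L.U (i l.1) := (inf_le_left.trans inf_le_left).trans (hle l)
      have e2 : W l ⊓ W m ⊓ W k ≤ L.U (i m.1) := (inf_le_left.trans inf_le_right).trans (hle m)
      have e3 : W l ⊓ W m ⊓ W k ≤ L.U (i k.1) := inf_le_right.trans (hle k)
      have := L.cocycle_res (i l.1) (i m.1) (i k.1) (le_inf (le_inf e1 e2) e3) (le_inf e1 e2)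
        (le_inf e2 e3) (le_inf e1 e3)
      rw [← coe_resU, ← coe_resU, ← coe_resU, resU_resU, resU_resU, resU_resU, ← Units.val_mul,
        this])
    htm htz hsurj hker ht0 (htg κ g' hc) (hd κ g' hc)
    (s0 := fun k => resU X0 (hpre k) (s00 (i k.1)))
    (by
      intro k l
      have e := congrArg (resU X0 (inf_le_inf (hpre k) (hpre l))) (hs00 (i k.1) (i l.1))
      have e' : resU X0 (inf_le_inf (hpre k) (hpre l))
        (mapU f (preimage_inf_le f (L.U (i k.1)) (L.U (i l.1))) (L.t (i k.1) (i l.1))) = _ := e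
      rw [map_mul, map_inv, resU_resU, resU_resU, resU_mapU] at e'
      rw [resU_resU, resU_resU, mapU_resU]
      exact e')
    hn (s := fun k => resU X (hle k) (sn (i k.1)))
    (by
      intro k l
      have e : resU X (inf_le_inf (hle k) (hle l)) (L.t (i k.1) (i l.1) ^ n) = _ :=
        congrArg (resU X (inf_le_inf (hle k) (hle l))) (hsn (i k.1) (i l.1))
      rw [map_mul, map_inv, resU_resU, resU_resU, map_pow] at e
      rw [resU_resU, resU_resU]
      exact e)
  rw [Pi.isUnit_iff] at hbu
  refine trivial_of_unit L (fun k => i k.1) hle hc (fun k => (hbu k).unit) ?_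
  intro k l
  apply Units.ext
  have := hb k l
  rw [pow_one] at this
  exact this

end final

end PartC5

section PartC6
set_option linter.style.haveILetI false
open AlgebraicGeometry CategoryTheory Opposite TopologicalSpace LineBundleOn

lemma depth_spec (B : Type u) [CommRing B] (z : ↥(Spec (CommRingCat.of B)))
    (hz : DepthGE ↥((Spec (CommRingCat.of B)).presheaf.stalk z) 2) :
    ∃ r1 ∈ (z : PrimeSpectrum B).asIdeal, ∃ r2 ∈ (z : PrimeSpectrum B).asIdeal,
      (∀ a, r1 * a = 0 → ∃ s ∉ (z : PrimeSpectrum B).asIdeal, s * a = 0) ∧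
      (∀ a b, r2 * a = r1 * b → ∃ s ∉ (z : PrimeSpectrum B).asIdeal, ∃ c, s * a = r1 * c) := by
  have hp : (z : PrimeSpectrum B).asIdeal.IsPrime := (z : PrimeSpectrum B).isPrime
  have hl : IsLocalRing ↥((Spec (CommRingCat.of B)).presheaf.stalk z) :=
    (Spec (CommRingCat.of B)).toLocallyRingedSpace.isLocalRing z
  exact @depthTwo_of_loc B _ (z : PrimeSpectrum B).asIdeal hp
    ↥((Spec (CommRingCat.of B)).presheaf.stalk z) _ hl (StructureSheaf.stalkAlgebra B z)
    (StructureSheaf.IsLocalization.to_stalk B z) hz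

lemma depth_transfer {A B : Type u} [CommRing A] [CommRing B] (e : A ≃+* B) (p : Ideal A)
    (q : Ideal B) (hpq : ∀ a, e a ∈ q ↔ a ∈ p)
    (h : ∃ r1 ∈ q, ∃ r2 ∈ q, (∀ a, r1 * a = 0 → ∃ s ∉ q, s * a = 0) ∧
      (∀ a b, r2 * a = r1 * b → ∃ s ∉ q, ∃ c, s * a = r1 * c)) :
    ∃ r1 ∈ p, ∃ r2 ∈ p, (∀ a, r1 * a = 0 → ∃ s ∉ p, s * a = 0) ∧
      (∀ a b, r2 * a = r1 * b → ∃ s ∉ p, ∃ c, s * a = r1 * c) := by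
  obtain ⟨r1, h1, r2, h2, h3, h4⟩ := h
  obtain ⟨r1, rfl⟩ := e.surjective r1
  obtain ⟨r2, rfl⟩ := e.surjective r2
  refine ⟨r1, (hpq _).mp h1, r2, (hpq _).mp h2, ?_, ?_⟩
  · intro a ha
    obtain ⟨s, hs, h5⟩ := h3 (e a) (by rw [← map_mul, ha, map_zero])
    obtain ⟨s, rfl⟩ := e.surjective s
    refine ⟨s, fun h => hs ((hpq _).mpr h), e.injective (by rw [map_mul, h5, map_zero])⟩
  · intro a b hab
    obtain ⟨s, hs, c, h5⟩ := h4 (e a) (e b) (by rw [← map_mul, hab, map_mul])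
    obtain ⟨s, rfl⟩ := e.surjective s
    obtain ⟨c, rfl⟩ := e.surjective c
    exact ⟨s, fun h => hs ((hpq _).mpr h), c, e.injective (by rw [map_mul, h5, map_mul])⟩

lemma glob_eq {R S : CommRingCat.{u}} (φ : R ⟶ S) (a : Γ(Spec R, ⊤)) :
    (Scheme.ΓSpecIso S).commRingCatIsoToRingEquiv (glob (Spec.map φ) a) =
      φ.hom ((Scheme.ΓSpecIso R).commRingCatIsoToRingEquiv a) := by
  have h := congrArg (fun ψ => ψ.hom a) (Scheme.ΓSpecIso_naturality φ)
  have h0 : glob (Spec.map φ) a = (Spec.map φ).appTop.hom a := by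
    simp only [glob, mapS, Scheme.Hom.appLE, Scheme.Hom.appTop]
    rw [show (homOfLE _ : (⊤ : (Spec S).Opens) ⟶ (Spec.map φ) ⁻¹ᵁ ⊤) = 𝟙 _ from rfl]
    erw [CategoryTheory.Functor.map_id]
    rfl
  rw [h0]
  exact h

lemma mem_bo {R : CommRingCat.{u}} (g : Γ(Spec R, ⊤)) (x : Spec R) :
    x ∈ (Spec R).basicOpen g ↔
      (Scheme.ΓSpecIso R).commRingCatIsoToRingEquiv g ∉ (x : PrimeSpectrum R).asIdeal := by
  rw [basicOpen_eq_of_affine']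
  exact Iff.rfl

theorem spec_main (R : Type u) [CommRing R] [IsDomain R] [IsDiscreteValuationRing R]
    (O : Type u) [CommRing O] [IsLocalRing O] [Algebra R O]
    (hflat : Module.Flat R O) (heft : Algebra.EssFiniteType R O)
    (hlocal : IsLocalHom (algebraMap R O))
    (Z0 : Set ↥(Spec (CommRingCat.of O)))
    (hZ0X0 : Z0 ⊆ Set.range (Spec.map (CommRingCat.ofHom
      (Ideal.Quotient.mk ((IsLocalRing.maximalIdeal R).map (algebraMap R O))))).base)
    (hdepth : ∀ z : ↥(Spec (CommRingCat.of
        (O ⧸ (IsLocalRing.maximalIdeal R).map (algebraMap R O)))),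
      (Spec.map (CommRingCat.ofHom
        (Ideal.Quotient.mk ((IsLocalRing.maximalIdeal R).map (algebraMap R O))))).base z ∈ Z0 →
      DepthGE ↥((Spec (CommRingCat.of
        (O ⧸ (IsLocalRing.maximalIdeal R).map (algebraMap R O)))).presheaf.stalk z) 2)
    (V : (Spec (CommRingCat.of O)).Opens)
    (hV : (V : Set ↥(Spec (CommRingCat.of O))) = Z0ᶜ)
    (L : LineBundleOn (Spec (CommRingCat.of O)) V)
    (htriv0 : (LineBundleOn.pullback (Spec.map (CommRingCat.ofHom
      (Ideal.Quotient.mk ((IsLocalRing.maximalIdeal R).map (algebraMap R O))))) L).IsTrivial)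
    (n : ℕ) (hn : 0 < n) (htors : (L.pow n).IsTrivial) :
    L.IsTrivial := by
  haveI := heft
  haveI := hlocal
  haveI : IsNoetherianRing O := Algebra.EssFiniteType.isNoetherianRing R O
  haveI : IsNoetherianRing (CommRingCat.of O) := ‹IsNoetherianRing O›
  obtain ⟨ϖ, hϖ⟩ := IsDiscreteValuationRing.exists_irreducible R
  have hI : (IsLocalRing.maximalIdeal R).map (algebraMap R O) =
      Ideal.span {algebraMap R O ϖ} := by
    rw [hϖ.maximalIdeal_eq, Ideal.map_span, Set.image_singleton]
  generalize hIdef : (IsLocalRing.maximalIdeal R).map (algebraMap R O) = I at *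
  let eO := (Scheme.ΓSpecIso (CommRingCat.of O)).commRingCatIsoToRingEquiv
  let eA := (Scheme.ΓSpecIso (CommRingCat.of (O ⧸ I))).commRingCatIsoToRingEquiv
  have hglob : ∀ a, eA (glob (Spec.map (CommRingCat.ofHom (Ideal.Quotient.mk I))) a) =
      Ideal.Quotient.mk I (eO a) := fun a => glob_eq _ a
  haveI : IsLocalRing Γ(Spec (CommRingCat.of O), ⊤) := RingEquiv.isLocalRing (A := O) eO.symm
  haveI : IsNoetherianRing Γ(Spec (CommRingCat.of O), ⊤) :=
    isNoetherianRing_of_ringEquiv O eO.symm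
  haveI : IsNoetherianRing Γ(Spec (CommRingCat.of (O ⧸ I)), ⊤) :=
    isNoetherianRing_of_ringEquiv (O ⧸ I) eA.symm
  have het : eO (eO.symm (algebraMap R O ϖ)) = algebraMap R O ϖ := eO.apply_symm_apply _
  generalize eO.symm (algebraMap R O ϖ) = t at het
  have hZV : ∀ x : ↥(Spec (CommRingCat.of O)), x ∉ V → x ∈ Z0 := by
    intro x hx
    by_contra h
    exact hx (show x ∈ (V : Set _) by rw [hV]; exact h)
  refine scheme_main (t := t) (f := Spec.map (CommRingCat.ofHom (Ideal.Quotient.mk I)))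
    ?_ ?_ ?_ ?_ ?_ ?_ ?_ ?_ L htriv0 n hn htors
  · rw [IsLocalRing.mem_maximalIdeal, mem_nonunits_iff]
    intro hu
    have h1 := hu.map eO
    rw [het] at h1
    exact hϖ.not_isUnit ((isUnit_map_iff (algebraMap R O) ϖ).mp h1)
  · intro a ha
    have h1 : ϖ • eO a = 0 := by
      rw [Algebra.smul_def]
      have := congrArg eO ha
      rwa [map_mul, het, map_zero] at this
    have h2 : eO a = 0 := by
      haveI := hflat
      haveI : Module.IsTorsionFree R O := inferInstance
      exact (smul_eq_zero.mp h1).resolve_left hϖ.ne_zero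
    exact eO.injective (by rw [h2, map_zero])
  · intro a
    obtain ⟨o, ho⟩ := Ideal.Quotient.mk_surjective (eA a)
    exact ⟨eO.symm o, eA.injective (by rw [hglob, eO.apply_symm_apply, ho])⟩
  · intro o ho
    have h1 := hglob o
    rw [ho, map_zero] at h1
    have h2 := Ideal.Quotient.eq_zero_iff_mem.mp h1.symm
    rw [hI, Ideal.mem_span_singleton] at h2
    obtain ⟨c, hc⟩ := h2
    exact ⟨eO.symm c, eO.injective (by rw [hc, map_mul, het, eO.apply_symm_apply])⟩
  · apply eA.injective
    rw [hglob, map_zero, het]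
    apply Ideal.Quotient.eq_zero_iff_mem.mpr
    rw [hI]
    exact Ideal.mem_span_singleton_self _
  · exact NoetherianSpace.isCompact _
  · intro κ g hVg p hp hgp
    let z : PrimeSpectrum (O ⧸ I) := ⟨p.comap (eA.symm : (O ⧸ I) →+* _), hp.comap _⟩
    have hz : ∀ a, eA a ∈ z.asIdeal ↔ a ∈ p := by
      intro a
      show eA.symm (eA a) ∈ p ↔ _
      rw [eA.symm_apply_apply]
    refine depth_transfer eA p z.asIdeal hz (depth_spec _ z (hdepth z (hZV _ ?_)))
    intro hzV
    obtain ⟨k, hk⟩ := Opens.mem_iSup.mp (hVg hzV)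
    rw [mem_bo] at hk
    apply hk
    show Ideal.Quotient.mk I (eO (g k)) ∈ z.asIdeal
    rw [← hglob, hz]
    exact hgp k
  · intro κ g hVg
    rw [Ideal.radical_eq_sInf, Submodule.mem_sInf]
    rintro p ⟨hgp, hp⟩
    haveI : Ideal.IsPrime p := hp
    let z : PrimeSpectrum O := 
      ⟨Ideal.comap (eO.symm : O ≃+* Γ(Spec (CommRingCat.of O), ⊤)) p, Ideal.IsPrime.comap _⟩
    have hz : ∀ a, eO a ∈ z.asIdeal ↔ a ∈ p := by
      intro a
      show eO.symm (eO a) ∈ p ↔ _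
      rw [eO.symm_apply_apply]
    have hz0 : (z : ↥(Spec (CommRingCat.of O))) ∈ Z0 := by
      apply hZV
      intro hzV
      obtain ⟨k, hk⟩ := Opens.mem_iSup.mp (hVg hzV)
      exact (mem_bo (g k) (z : ↥(Spec (CommRingCat.of O)))).mp hk ((hz _).mpr (hgp (Ideal.subset_span ⟨k, rfl⟩)))
    obtain ⟨y, hy⟩ := hZ0X0 hz0
    rw [← hz, het, ← hy]
    show Ideal.Quotient.mk I (algebraMap R O ϖ) ∈ (y : PrimeSpectrum (O ⧸ I)).asIdeal
    have : Ideal.Quotient.mk I (algebraMap R O ϖ) = 0 := by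
      apply Ideal.Quotient.eq_zero_iff_mem.mpr
      rw [hI]
      exact Ideal.mem_span_singleton_self _
    rw [this]
    exact Ideal.zero_mem _


end PartC6

open LineBundleOn in
/-- Let `T` be the spectrum of a DVR `R` with closed point `0`, and
`f : (x, X) → (0, T)` a flat morphism, essentially of finite type, from a local scheme
`(x, X) = Spec O`.  Let `Z0` be a closed subscheme of the special fiber
`X0 = Spec (O/m_R O)` containing `x` with `depth_{Z0} X0 ≥ 2`. Then the kernel of the
restriction map `Pic(X \ Z0) → Pic(X0 \ Z0)` is torsion free: if a line bundle `L` on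
`X \ Z0` restricts to the trivial bundle on `X0 \ Z0` and some positive tensor power
of `L` is trivial, then `L` is trivial. -/
theorem stmt_15 (R : Type u) [CommRing R] [IsDomain R] [IsDiscreteValuationRing R]
    (O : Type u) [CommRing O] [IsLocalRing O] [Algebra R O]
    (hflat : Module.Flat R O) (heft : Algebra.EssFiniteType R O)
    (hlocal : IsLocalHom (algebraMap R O))
    (Z0 : Set ↥(Spec (CommRingCat.of O))) (hZ0cl : IsClosed Z0)
    (hZ0X0 : Z0 ⊆ Set.range (Spec.map (CommRingCat.ofHom
      (Ideal.Quotient.mk ((IsLocalRing.maximalIdeal R).map (algebraMap R O))))).base)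
    (hxZ0 : (IsLocalRing.closedPoint O : PrimeSpectrum O) ∈ Z0)
    (hdepth : ∀ z : ↥(Spec (CommRingCat.of
        (O ⧸ (IsLocalRing.maximalIdeal R).map (algebraMap R O)))),
      (Spec.map (CommRingCat.ofHom
        (Ideal.Quotient.mk ((IsLocalRing.maximalIdeal R).map (algebraMap R O))))).base z ∈ Z0 →
      DepthGE ↥((Spec (CommRingCat.of
        (O ⧸ (IsLocalRing.maximalIdeal R).map (algebraMap R O)))).presheaf.stalk z) 2)
    (V : (Spec (CommRingCat.of O)).Opens)
    (hV : (V : Set ↥(Spec (CommRingCat.of O))) = Z0ᶜ)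
    (L : LineBundleOn (Spec (CommRingCat.of O)) V)
    (htriv0 : (LineBundleOn.pullback (Spec.map (CommRingCat.ofHom
      (Ideal.Quotient.mk ((IsLocalRing.maximalIdeal R).map (algebraMap R O))))) L).IsTrivial)
    (n : ℕ) (hn : 0 < n) (htors : (L.pow n).IsTrivial) :
    L.IsTrivial := by
  exact spec_main R O hflat heft hlocal Z0 hZ0X0 hdepth V hV L htriv0 n hn htors

end LocalPic
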